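/- arXiv:math/0610980 — 3 statements merged into one kernel-verified Lean document; each statement's English description precedes it below -/
import Mathlib

section
/- Let Γ be a finite connected triangle-free simplicial graph with at least two edges which is not a star. Let A ≤ Aut(A_Γ) be the free abelian subgroup generated, for each vertex v ∉ V0 together with a chosen w ∈ V0 with lk(v) ⊆ lk(w), by the left and right transvections v ↦ wv and v ↦ vw; let L ≤ Aut(A_Γ) be the subgroup generated by all leaf transvections; and let C ≤ Aut(A_Γ) be the subgroup generated by the partial conjugations by a vertex v of a single connected component of Γ − {v}. Then the image G in Out(A_Γ) of the subgroup generated by A, L and C is free abelian of rank 2·|V∖V0| + Σ_{v∈V0} (δ_C(v) − τ(v) − 1), where δ_C(v) is the number of connected components of Γ − {v} and τ(v) is the number of twigs at v. -/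
noncomputable section

/-! ### Outer automorphism groups -/

/-- The subgroup of inner automorphisms of `G` inside `MulAut G`. -/
def Inn (G : Type*) [Group G] : Subgroup (MulAut G) := (MulAut.conj : G →* MulAut G).range

instance Inn.normal (G : Type*) [Group G] : (Inn G).Normal := by
  constructor
  intro n hn φ
  obtain ⟨g, rfl⟩ := hn
  refine ⟨φ g, ?_⟩
  ext x
  simp [MulAut.conj_apply, MulAut.mul_apply, map_mul, map_inv, mul_assoc]

/-- The outer automorphism group of `G`. -/
abbrev Out (G : Type*) [Group G] := MulAut G ⧸ Inn G

/-! ### Right-angled Artin groups -/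

variable {V : Type*}

/-- The commutator relations defining a right-angled Artin group. -/
def raagRels (Γ : SimpleGraph V) : Set (FreeGroup V) :=
  {r | ∃ v w : V, Γ.Adj v w ∧
    r = FreeGroup.of v * FreeGroup.of w * (FreeGroup.of v)⁻¹ * (FreeGroup.of w)⁻¹}

/-- The right-angled Artin group associated to a simple graph. -/
abbrev RAAG (Γ : SimpleGraph V) := PresentedGroup (raagRels Γ)

/-- The generator of `RAAG Γ` corresponding to a vertex. -/
def raagGen (Γ : SimpleGraph V) (v : V) : RAAG Γ := PresentedGroup.of v

/-- The special subgroup generated by the vertices in `Θ`. -/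
def SpecialSubgroup (Γ : SimpleGraph V) (Θ : Set V) : Subgroup (RAAG Γ) :=
  Subgroup.closure (raagGen Γ '' Θ)

/-! ### Graph-theoretic notions -/

/-- The link of a vertex. -/
def lk (Γ : SimpleGraph V) (v : V) : Set V := Γ.neighborSet v

/-- The (closed) star of a vertex. -/
def starOf (Γ : SimpleGraph V) (v : V) : Set V := insert v (Γ.neighborSet v)

/-- `Θ⊥`: the intersection of the closed stars of the vertices of `Θ`. -/
def perp (Γ : SimpleGraph V) (Θ : Set V) : Set V := ⋂ v ∈ Θ, starOf Γ v

/-- A leaf is a vertex of valence one. -/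
def IsLeaf (Γ : SimpleGraph V) (v : V) : Prop := ∃ w, Γ.neighborSet v = {w}

/-- The vertex set of the maximal join `J_v = L_v * L_v⊥` associated to a vertex `v`. -/
def JoinOf (Γ : SimpleGraph V) (v : V) : Set V := lk Γ v ∪ perp Γ (lk Γ v)

/-- A vertex is cyclic if `L_v⊥ = {v}`. -/
def IsCyclicVertex (Γ : SimpleGraph V) (v : V) : Prop := perp Γ (lk Γ v) = {v}

/-- `C` is a connected component of the full subgraph of `Γ` spanned by `S`. -/
def IsComponentOf (Γ : SimpleGraph V) (S C : Set V) : Prop :=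
  C ⊆ S ∧ C.Nonempty ∧ (Γ.induce C).Connected ∧
    ∀ x ∈ C, ∀ y ∈ S, Γ.Adj x y → y ∈ C

/-- A separating vertex: `Γ − {v}` is disconnected. -/
def IsSeparating (Γ : SimpleGraph V) (v : V) : Prop :=
  Set.Nonempty ({v}ᶜ : Set V) ∧ ¬ (Γ.induce ({v}ᶜ : Set V)).Connected

/-- `δ_C(v)`: the number of connected components of `Γ − {v}`. -/
noncomputable def deltaC (Γ : SimpleGraph V) (v : V) : ℕ :=
  {C : Set V | IsComponentOf Γ ({v}ᶜ : Set V) C}.ncard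

/-- `ℓ(v)`: the number of leaves adjacent to `v`. -/
noncomputable def nAdjLeaves (Γ : SimpleGraph V) (v : V) : ℕ :=
  {w : V | Γ.Adj v w ∧ IsLeaf Γ w}.ncard

/-- A twig at `v`: a non-singleton component of `Γ − {v}` contained in the ball of
radius 2 about `v` (as a metric space, so every edge must have an endpoint adjacent
to `v`). -/
def IsTwigOf (Γ : SimpleGraph V) (v : V) (C : Set V) : Prop :=
  IsComponentOf Γ ({v}ᶜ : Set V) C ∧ (¬ ∃ w, C = {w}) ∧
  (∀ x ∈ C, Γ.dist v x ≤ 2) ∧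
  ∀ x ∈ C, ∀ y ∈ C, Γ.Adj x y → (Γ.Adj v x ∨ Γ.Adj v y)

/-- `τ(v)`: the number of twigs at `v`. -/
noncomputable def nTwigs (Γ : SimpleGraph V) (v : V) : ℕ := {C : Set V | IsTwigOf Γ v C}.ncard

/-- `Γ` is the star `{v} * W`. -/
def IsStarGraph (Γ : SimpleGraph V) (v : V) : Prop :=
  ∀ x y, Γ.Adj x y ↔ (x = v ∧ y ≠ v) ∨ (y = v ∧ x ≠ v)

/-- The link-equivalence class of `v` is maximal. -/
def HasMaximalLink (Γ : SimpleGraph V) (v : V) : Prop :=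
  ∀ w, lk Γ v ⊆ lk Γ w → lk Γ w = lk Γ v

/-- `V0` is a set of representatives, one from each maximal link-equivalence class
(with the convention `V0 = {v}` when `Γ` is a star `{v} * W`). -/
def IsV0 (Γ : SimpleGraph V) (V0 : Set V) : Prop :=
  (∃ v, IsStarGraph Γ v ∧ V0 = {v}) ∨
  ((¬ ∃ v, IsStarGraph Γ v) ∧
    (∀ v ∈ V0, HasMaximalLink Γ v) ∧
    (∀ v ∈ V0, ∀ w ∈ V0, lk Γ v = lk Γ w → v = w) ∧
    (∀ w, HasMaximalLink Γ w → ∃ v ∈ V0, lk Γ v = lk Γ w))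

/-- A join `U * W` (as a full subgraph of `Γ`): a complete bipartite full subgraph. -/
def IsJoin (Γ : SimpleGraph V) (U W : Set V) : Prop :=
  U.Nonempty ∧ W.Nonempty ∧ Disjoint U W ∧
  (∀ u ∈ U, ∀ w ∈ W, Γ.Adj u w) ∧
  (∀ u ∈ U, ∀ u' ∈ U, ¬ Γ.Adj u u') ∧
  (∀ w ∈ W, ∀ w' ∈ W, ¬ Γ.Adj w w')

/-- A maximal join: a join not properly contained in any other join subgraph. -/
def IsMaximalJoin (Γ : SimpleGraph V) (U W : Set V) : Prop :=
  IsJoin Γ U W ∧ ∀ U' W', IsJoin Γ U' W' → U ∪ W ⊆ U' ∪ W' → U ∪ W = U' ∪ W'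

/-! ### Generating automorphisms and `Aut⁰`, `Out⁰` -/

/-- `φ` is the inversion at the vertex `v`. -/
def IsInversionAt (Γ : SimpleGraph V) (φ : MulAut (RAAG Γ)) (v : V) : Prop :=
  φ (raagGen Γ v) = (raagGen Γ v)⁻¹ ∧ ∀ w, w ≠ v → φ (raagGen Γ w) = raagGen Γ w

/-- `φ` conjugates the generators in `C` by `v` and fixes all other generators. -/
def IsPartialConjBy (Γ : SimpleGraph V) (φ : MulAut (RAAG Γ)) (v : V) (C : Set V) : Prop :=
  (∀ x ∈ C, φ (raagGen Γ x) = (raagGen Γ v)⁻¹ * raagGen Γ x * raagGen Γ v) ∧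
  (∀ x, x ∉ C → φ (raagGen Γ x) = raagGen Γ x)

/-- `φ` is the (right) transvection `w ↦ wv` (defined when `st(v) ⊇ lk(w)`). -/
def IsTransvection (Γ : SimpleGraph V) (φ : MulAut (RAAG Γ)) (w v : V) : Prop :=
  v ≠ w ∧ lk Γ w ⊆ starOf Γ v ∧
  φ (raagGen Γ w) = raagGen Γ w * raagGen Γ v ∧
  ∀ x, x ≠ w → φ (raagGen Γ x) = raagGen Γ x

/-- The group of pure automorphisms `Aut⁰(A_Γ)`. -/
def Aut0 (Γ : SimpleGraph V) : Subgroup (MulAut (RAAG Γ)) :=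
  Subgroup.closure
    ({φ | φ ∈ Inn (RAAG Γ)} ∪ {φ | ∃ v, IsInversionAt Γ φ v} ∪
     {φ | ∃ v C, IsComponentOf Γ ((starOf Γ v)ᶜ) C ∧ IsPartialConjBy Γ φ v C} ∪
     {φ | ∃ w v, IsTransvection Γ φ w v})

/-- The group of pure outer automorphisms `Out⁰(A_Γ)`. -/
def Out0 (Γ : SimpleGraph V) : Subgroup (Out (RAAG Γ)) :=
  (Aut0 Γ).map (QuotientGroup.mk' (Inn (RAAG Γ)))


/-- `φ` is the left transvection `x ↦ ux` (defined when `st(u) ⊇ lk(x)`). -/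
def IsLeftTransvection (Γ : SimpleGraph V) (φ : MulAut (RAAG Γ)) (x u : V) : Prop :=
  u ≠ x ∧ lk Γ x ⊆ starOf Γ u ∧
  φ (raagGen Γ x) = raagGen Γ u * raagGen Γ x ∧
  ∀ y, y ≠ x → φ (raagGen Γ y) = raagGen Γ y

/-! ### Connectivity of the complement of a vertex -/

section GraphLemmas

variable {Γ : SimpleGraph V}

lemma eq_univ_of_connected (hconn : Γ.Connected) {s : Set V} (hs : s.Nonempty)
    (hcl : ∀ x ∈ s, ∀ y, Γ.Adj x y → y ∈ s) : s = Set.univ := by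
  obtain ⟨x, hx⟩ := hs
  refine Set.eq_univ_of_forall fun y => ?_
  obtain ⟨w⟩ := hconn.preconnected x y
  induction w with
  | nil => exact hx
  | cons h _ ih => exact ih (hcl _ hx _ h)

lemma subset_of_induce_connected {C D : Set V} (hC : (Γ.induce C).Connected)
    (hCD : (C ∩ D).Nonempty) (hcl : ∀ x ∈ C ∩ D, ∀ y ∈ C, Γ.Adj x y → y ∈ D) : C ⊆ D := by
  obtain ⟨x, hxC, hxD⟩ := hCD
  have h := eq_univ_of_connected hC (s := Subtype.val ⁻¹' D) ⟨⟨x, hxC⟩, hxD⟩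
    (fun a ha b hab => hcl a ⟨a.2, ha⟩ b b.2 hab)
  intro y hy
  have : (⟨y, hy⟩ : C) ∈ (Subtype.val ⁻¹' D : Set C) := h ▸ Set.mem_univ _
  exact this

lemma IsComponentOf.eq {S C D : Set V} (hC : IsComponentOf Γ S C) (hD : IsComponentOf Γ S D)
    {x : V} (hxC : x ∈ C) (hxD : x ∈ D) : C = D := by
  apply Set.Subset.antisymm
  · exact subset_of_induce_connected hC.2.2.1 ⟨x, hxC, hxD⟩
      fun a ha b hb hab => hD.2.2.2 a ha.2 b (hC.1 hb) hab
  · exact subset_of_induce_connected hD.2.2.1 ⟨x, hxD, hxC⟩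
      fun a ha b hb hab => hC.2.2.2 a ha.2 b (hD.1 hb) hab

lemma induce_singleton_connected (x : V) : (Γ.induce {x}).Connected := by
  refine ⟨?_⟩
  rintro ⟨a, rfl⟩ ⟨b, hb⟩
  cases hb
  rfl

lemma isComponentOf_singleton {v w : V} (hwv : w ≠ v) (hw : ∀ y, Γ.Adj w y → y = v) :
    IsComponentOf Γ ({v}ᶜ : Set V) {w} := by
  refine ⟨by simpa using hwv.symm, ⟨w, rfl⟩, induce_singleton_connected w, ?_⟩
  rintro _ rfl y hy hwy
  exact absurd (hw y hwy) hy

lemma exists_isComponentOf [Finite V] (Γ : SimpleGraph V) {S : Set V} {x : V} (hx : x ∈ S) :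
    ∃ C, IsComponentOf Γ S C ∧ x ∈ C := by
  have hfin : {C : Set V | C ⊆ S ∧ x ∈ C ∧ (Γ.induce C).Connected}.Finite := Set.toFinite _
  obtain ⟨C, hC⟩ := hfin.exists_maximal
    ⟨{x}, by simpa using hx, rfl, induce_singleton_connected x⟩
  refine ⟨C, ⟨hC.prop.1, ⟨x, hC.prop.2.1⟩, hC.prop.2.2, ?_⟩, hC.prop.2.1⟩
  intro a ha b hb hab
  have hconn : (Γ.induce (C ∪ {a, b})).Connected :=
    SimpleGraph.induce_union_connected hC.prop.2.2.preconnected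
      (SimpleGraph.induce_pair_connected_of_adj hab).preconnected ⟨a, ha, by simp⟩
  have := hC.le_of_ge (y := C ∪ {a, b})
    ⟨Set.union_subset hC.prop.1 (by
      rintro z (rfl | rfl)
      exacts [hC.prop.1 ha, hb]), Or.inl hC.prop.2.1, hconn⟩ Set.subset_union_left
  exact this (Or.inr (by simp))

lemma IsComponentOf.ne {v x : V} {C : Set V} (hC : IsComponentOf Γ ({v}ᶜ : Set V) C)
    (hx : x ∈ C) : x ≠ v := hC.1 hx

lemma IsComponentOf.mem_of_adj {v x y : V} {C : Set V} (hC : IsComponentOf Γ ({v}ᶜ : Set V) C)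
    (hx : x ∈ C) (hxy : Γ.Adj x y) (hy : y ≠ v) : y ∈ C :=
  hC.2.2.2 x hx y hy hxy

/-- Deleting one of two vertices leaves any third vertex connected to the other one, for at least
one of the two choices. -/
lemma mem_component_or_mem_component (hconn : Γ.Connected) {u v x : V} (huv : u ≠ v)
    {C D : Set V} (hC : IsComponentOf Γ ({u}ᶜ : Set V) C) (hD : IsComponentOf Γ ({v}ᶜ : Set V) D)
    (hxC : x ∈ C) (hxD : x ∈ D) : v ∈ C ∨ u ∈ D := by
  by_contra! h
  have huniv := eq_univ_of_connected hconn (s := C ∩ D) ⟨x, hxC, hxD⟩ (by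
    rintro y ⟨hyC, hyD⟩ z hyz
    by_cases hzu : z = u
    · subst hzu
      exact absurd (hD.mem_of_adj hyD hyz huv) h.2
    · have hzC := hC.mem_of_adj hyC hyz hzu
      refine ⟨hzC, hD.mem_of_adj hyD hyz ?_⟩
      rintro rfl
      exact h.1 hzC)
  have : u ∈ C ∩ D := huniv ▸ Set.mem_univ u
  exact h.2 this.2

end GraphLemmas

/-- A choice `V0` of vertices with maximal links, together with a map `c` assigning to every
other vertex one of these whose link contains its own. -/
structure IsMaximalSystem (Γ : SimpleGraph V) (V0 : Finset V) (c : V → V) : Prop where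
  connected : Γ.Connected
  not_adj : ∀ {x y z}, Γ.Adj x y → Γ.Adj y z → ¬ Γ.Adj x z
  not_star : ¬ ∃ v, IsStarGraph Γ v
  maximal : ∀ v ∈ V0, HasMaximalLink Γ v
  unique : ∀ v ∈ V0, ∀ w ∈ V0, lk Γ v = lk Γ w → v = w
  rep_mem : ∀ v ∉ V0, c v ∈ V0
  lk_rep : ∀ v ∉ V0, lk Γ v ⊆ lk Γ (c v)

namespace IsMaximalSystem

variable {Γ : SimpleGraph V} {V0 : Finset V} {c : V → V}

lemma adj_rep (h : IsMaximalSystem Γ V0 c) {x y : V} (hx : x ∉ V0) (hxy : Γ.Adj x y) :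
    Γ.Adj (c x) y := h.lk_rep x hx hxy

lemma rep_ne (h : IsMaximalSystem Γ V0 c) {x : V} (hx : x ∉ V0) : c x ≠ x := fun he =>
  hx (he ▸ h.rep_mem x hx)

lemma exists_adj (h : IsMaximalSystem Γ V0 c) (x : V) : ∃ y, Γ.Adj x y := by
  by_contra! hx
  have huniv := eq_univ_of_connected h.connected (s := {x}) ⟨x, rfl⟩ (by
    rintro _ rfl y hy
    exact absurd hy (hx y))
  have hall : ∀ y, y = x := fun y => by
    have : y ∈ ({x} : Set V) := huniv ▸ Set.mem_univ y
    exact this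
  exact h.not_star ⟨x, fun a b => by simp [hall a, hall b]⟩

lemma not_adj_rep (h : IsMaximalSystem Γ V0 c) {x : V} (hx : x ∉ V0) : ¬ Γ.Adj (c x) x := by
  intro hadj
  exact (h.adj_rep hx hadj.symm).ne rfl

lemma isStarGraph_of_forall (h : IsMaximalSystem Γ V0 c) {v : V}
    (hv : ∀ x y, x ≠ v → Γ.Adj x y → y = v) : IsStarGraph Γ v := by
  have hadj : ∀ x, x ≠ v → Γ.Adj x v := fun x hx => by
    obtain ⟨y, hy⟩ := h.exists_adj x
    exact hv x y hx hy ▸ hy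
  intro x y
  constructor
  · intro hxy
    by_cases hx : x = v
    · exact Or.inl ⟨hx, fun hy => hxy.ne (hx.trans hy.symm)⟩
    · exact Or.inr ⟨hv x y hx hxy, hx⟩
  · rintro (⟨rfl, hy⟩ | ⟨rfl, hx⟩)
    · exact (hadj y hy).symm
    · exact hadj x hx

lemma leaf_notMem (h : IsMaximalSystem Γ V0 c) {v w : V} (hw : ∀ y, Γ.Adj w y → y = v) :
    w ∉ V0 := by
  intro hwV
  have hwv : Γ.Adj w v := by
    obtain ⟨y, hy⟩ := h.exists_adj w
    exact hw y hy ▸ hy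
  have hnbr : ∀ y, Γ.Adj v y → ∀ z, Γ.Adj y z → z = v := by
    intro y hy z hz
    have heq := h.maximal w hwV y (fun a ha => by
      rw [hw a ha]
      exact hy.symm)
    have : z ∈ lk Γ w := heq ▸ hz
    exact hw z this
  refine h.not_star ⟨v, h.isStarGraph_of_forall fun x y hx hxy => ?_⟩
  have huniv := eq_univ_of_connected h.connected (s := insert v (Γ.neighborSet v)) ⟨v, by simp⟩ (by
    rintro a (rfl | ha) b hab
    · exact Or.inr hab
    · exact Or.inl (hnbr a ha b hab))
  have hxm : x ∈ insert v (Γ.neighborSet v) := huniv ▸ Set.mem_univ x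
  exact hnbr x (hxm.resolve_left hx) y hxy

lemma adj_of_singleton (h : IsMaximalSystem Γ V0 c) {v w : V}
    (hw : IsComponentOf Γ ({v}ᶜ : Set V) {w}) :
    Γ.Adj w v ∧ ∀ y, Γ.Adj w y → y = v := by
  have hall : ∀ y, Γ.Adj w y → y = v := fun y hy => by
    by_contra hyv
    exact hy.ne (hw.mem_of_adj rfl hy hyv).symm
  obtain ⟨y, hy⟩ := h.exists_adj w
  exact ⟨hall y hy ▸ hy, hall⟩

lemma exists_nonsingleton_component [Finite V] (h : IsMaximalSystem Γ V0 c) (v : V) :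
    ∃ C, IsComponentOf Γ ({v}ᶜ : Set V) C ∧ ¬ ∃ w, C = {w} := by
  by_contra! hall
  refine h.not_star ⟨v, h.isStarGraph_of_forall fun x y hx hxy => ?_⟩
  obtain ⟨C, hC, hxC⟩ := exists_isComponentOf Γ (S := {v}ᶜ) (x := x) hx
  obtain ⟨w, rfl⟩ := hall C hC
  cases hxC
  exact (h.adj_of_singleton hC).2 y hxy

lemma eq_compl_of_notMem (h : IsMaximalSystem Γ V0 c) {v : V} (hv : v ∉ V0) {C : Set V}
    (hC : IsComponentOf Γ ({v}ᶜ : Set V) C) : C = {v}ᶜ := by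
  obtain ⟨x, hx⟩ := hC.2.1
  have hcC : c v ∈ C := by
    by_contra hcC
    have huniv := eq_univ_of_connected h.connected (s := C) ⟨x, hx⟩ (by
      intro a ha b hab
      by_cases hbv : b = v
      · subst hbv
        exact absurd (hC.mem_of_adj ha (h.adj_rep hv hab.symm).symm (h.rep_ne hv)) hcC
      · exact hC.mem_of_adj ha hab hbv)
    have : v ∈ C := huniv ▸ Set.mem_univ v
    exact hC.ne this rfl
  have huniv := eq_univ_of_connected h.connected (s := insert v C) ⟨v, by simp⟩ (by
    rintro a (rfl | ha) b hab
    · exact Or.inr (hC.mem_of_adj hcC (h.adj_rep hv hab) hab.ne')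
    · by_cases hbv : b = v
      · exact Or.inl hbv
      · exact Or.inr (hC.mem_of_adj ha hab hbv))
  refine Set.Subset.antisymm hC.1 fun y hy => ?_
  have hym : y ∈ insert v C := huniv ▸ Set.mem_univ y
  exact hym.resolve_left hy

/-- Every vertex of a twig at `v` is adjacent to `v`, or is represented by `v`. -/
lemma rep_eq_of_twig (h : IsMaximalSystem Γ V0 c) {v : V} (hv : v ∈ V0) {C : Set V}
    (hC : IsTwigOf Γ v C) {x : V} (hx : x ∈ C) (hvx : ¬ Γ.Adj v x) : x ∉ V0 ∧ c x = v := by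
  obtain ⟨hC, -, -, hedge⟩ := hC
  have hlk : ∀ z ∈ C, ¬ Γ.Adj v z → lk Γ z ⊆ lk Γ v := by
    intro z hz hvz y hy
    have hyv : y ≠ v := by
      rintro rfl
      exact hvz hy.symm
    exact (hedge z hz y (hC.mem_of_adj hz hy hyv) hy).resolve_left hvz
  have hV0 : ∀ z ∈ C, ¬ Γ.Adj v z → z ∉ V0 := fun z hz hvz hzV =>
    hC.ne hz (h.unique v hv z hzV (h.maximal z hzV v (hlk z hz hvz))).symm
  have hxV := hV0 x hx hvx
  refine ⟨hxV, ?_⟩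
  by_contra hne
  obtain ⟨y, hxy⟩ := h.exists_adj x
  have hvy : Γ.Adj v y := hlk x hx hvx hxy
  have hcy := h.adj_rep hxV hxy
  exact hV0 (c x) (hC.mem_of_adj (hC.mem_of_adj hx hxy hvy.ne') hcy.symm hne)
    (h.not_adj hvy hcy.symm) (h.rep_mem x hxV)

/-- A component which is neither a leaf component nor a twig contains an edge avoiding the star
of `v`. -/
lemma exists_edge_of_branch (h : IsMaximalSystem Γ V0 c) {v : V} {C : Set V}
    (hC : IsComponentOf Γ ({v}ᶜ : Set V) C) (hs : ¬ ∃ w, C = {w}) (ht : ¬ IsTwigOf Γ v C) :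
    ∃ x ∈ C, ∃ y ∈ C, Γ.Adj x y ∧ ¬ Γ.Adj v x ∧ ¬ Γ.Adj v y := by
  by_contra! hcon
  refine ht ⟨hC, hs, fun x hx => ?_, fun x hx y hy hxy => or_iff_not_imp_left.2 (hcon x hx y hy hxy)⟩
  by_cases hvx : Γ.Adj v x
  · exact (SimpleGraph.dist_le (SimpleGraph.Walk.cons hvx .nil)).trans (by simp)
  · obtain ⟨y, hxy⟩ := h.exists_adj x
    have hyv : y ≠ v := by
      rintro rfl
      exact hvx hxy.symm
    have hvy := hcon x hx y (hC.mem_of_adj hx hxy hyv) hxy hvx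
    exact (SimpleGraph.dist_le (SimpleGraph.Walk.cons hvy (.cons hxy.symm .nil))).trans (by simp)

lemma exists_mem_of_branch (h : IsMaximalSystem Γ V0 c) {v : V} {C : Set V}
    (hC : IsComponentOf Γ ({v}ᶜ : Set V) C) (hs : ¬ ∃ w, C = {w}) (ht : ¬ IsTwigOf Γ v C) :
    ∃ x ∈ C, x ∈ V0 ∧ ¬ Γ.Adj v x := by
  obtain ⟨x, hx, y, hy, hxy, hvx, hvy⟩ := h.exists_edge_of_branch hC hs ht
  have key : ∀ a ∈ C, ∀ b ∈ C, Γ.Adj a b → ¬ Γ.Adj v b → ∃ a' ∈ C, a' ∈ V0 ∧ Γ.Adj a' b := by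
    intro a ha b hb hab hvb
    by_cases haV : a ∈ V0
    · exact ⟨a, ha, haV, hab⟩
    · have hcb := h.adj_rep haV hab
      refine ⟨c a, hC.mem_of_adj hb hcb.symm ?_, h.rep_mem a haV, hcb⟩
      intro he
      exact hvb (he ▸ hcb)
  obtain ⟨x', hx', hx'V, hx'y⟩ := key x hx y hy hxy hvy
  by_cases hvx' : Γ.Adj v x'
  · by_cases hyV : y ∈ V0
    · exact ⟨y, hy, hyV, hvy⟩
    · have hcx := h.adj_rep hyV hx'y.symm
      have hcv : c y ≠ v := by
        intro he
        exact hvx (he ▸ h.adj_rep hyV hxy.symm)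
      exact ⟨c y, hC.mem_of_adj hx' hcx.symm hcv, h.rep_mem y hyV, h.not_adj hvx' hcx.symm⟩
  · exact ⟨x', hx', hx'V, hvx'⟩

end IsMaximalSystem

/-! ### Automorphisms multiplying generators by powers of a fixed generator -/

section Twist

variable {Γ : SimpleGraph V}

lemma raagGen_commute {x y : V} (hxy : Γ.Adj x y) : Commute (raagGen Γ x) (raagGen Γ y) := by
  have h : (PresentedGroup.mk (raagRels Γ)) (FreeGroup.of x * FreeGroup.of y *
      (FreeGroup.of x)⁻¹ * (FreeGroup.of y)⁻¹) = 1 :=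
    PresentedGroup.one_of_mem ⟨x, y, hxy, rfl⟩
  simp only [map_mul, map_inv] at h
  change raagGen Γ x * raagGen Γ y * (raagGen Γ x)⁻¹ * (raagGen Γ y)⁻¹ = 1 at h
  change raagGen Γ x * raagGen Γ y = raagGen Γ y * raagGen Γ x
  rw [mul_inv_eq_one, mul_inv_eq_iff_eq_mul] at h
  exact h

/-- The homomorphism out of a right-angled Artin group with prescribed values on generators. -/
def raagLift {G : Type*} [Group G] (f : V → G) (hf : ∀ x y, Γ.Adj x y → Commute (f x) (f y)) :
    RAAG Γ →* G :=
  PresentedGroup.toGroup (f := f) (by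
    rintro _ ⟨x, y, hxy, rfl⟩
    simp only [map_mul, map_inv, FreeGroup.lift_apply_of]
    rw [mul_inv_eq_one, mul_inv_eq_iff_eq_mul]
    exact hf x y hxy)

@[simp]
lemma raagLift_gen {G : Type*} [Group G] (f : V → G)
    (hf : ∀ x y, Γ.Adj x y → Commute (f x) (f y)) (x : V) :
    raagLift f hf (raagGen Γ x) = f x :=
  PresentedGroup.toGroup.of _

lemma raagHom_ext {G : Type*} [Group G] {f g : RAAG Γ →* G}
    (h : ∀ x, f (raagGen Γ x) = g (raagGen Γ x)) : f = g :=
  PresentedGroup.ext h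

lemma raagAut_ext {f g : MulAut (RAAG Γ)} (h : ∀ x, f (raagGen Γ x) = g (raagGen Γ x)) :
    f = g := by
  have : f.toMonoidHom = g.toMonoidHom := raagHom_ext h
  exact MulEquiv.toMonoidHom_injective this

/-- The exponent functions `p` for which `x ↦ v ^ (p x).1 * x * v ^ (p x).2` defines one of the
automorphisms considered here: apart from the vertices represented by `v`, they are constant on
components of `Γ - {v}`, and act by conjugation unless the vertex is a leaf at `v`. -/
def twists (Γ : SimpleGraph V) (V0 : Finset V) (c : V → V) (v : V) : AddSubgroup (V → ℤ × ℤ) where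
  carrier := {p | p v = 0 ∧
    (∀ x, ¬ (x ∉ V0 ∧ c x = v) → (∃ y, y ≠ v ∧ Γ.Adj x y) → (p x).1 + (p x).2 = 0) ∧
    ∀ C, IsComponentOf Γ ({v}ᶜ : Set V) C → ∀ x ∈ C, ∀ y ∈ C, ¬ (x ∉ V0 ∧ c x = v) →
      ¬ (y ∉ V0 ∧ c y = v) → p x = p y}
  zero_mem' := by simp
  add_mem' := by
    rintro p q ⟨hp1, hp2, hp3⟩ ⟨hq1, hq2, hq3⟩
    refine ⟨by simp [hp1, hq1], fun x hx hy => ?_, fun C hC x hx y hy hx' hy' => ?_⟩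
    · have h1 := hp2 x hx hy
      have h2 := hq2 x hx hy
      simp only [Pi.add_apply, Prod.fst_add, Prod.snd_add]
      linarith
    · simp [hp3 C hC x hx y hy hx' hy', hq3 C hC x hx y hy hx' hy']
  neg_mem' := by
    rintro p ⟨hp1, hp2, hp3⟩
    refine ⟨by simp [hp1], fun x hx hy => ?_, fun C hC x hx y hy hx' hy' => ?_⟩
    · have h1 := hp2 x hx hy
      simp only [Pi.neg_apply, Prod.fst_neg, Prod.snd_neg]
      linarith
    · simp [hp3 C hC x hx y hy hx' hy']

variable {V0 : Finset V} {c : V → V}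

lemma twists_commute [Finite V] (h : IsMaximalSystem Γ V0 c) {v : V} {p : V → ℤ × ℤ}
    (hp : p ∈ twists Γ V0 c v) {x y : V} (hxy : Γ.Adj x y) :
    Commute (raagGen Γ v ^ (p x).1 * raagGen Γ x * raagGen Γ v ^ (p x).2)
      (raagGen Γ v ^ (p y).1 * raagGen Γ y * raagGen Γ v ^ (p y).2) := by
  obtain ⟨hp1, hp2, hp3⟩ := hp
  have hcen : ∀ z, Γ.Adj v z → ∀ k : ℤ, Commute (raagGen Γ v ^ k) (raagGen Γ z) := fun z hz k =>
    (raagGen_commute hz).zpow_left k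
  have key : ∀ a b, Γ.Adj a b → b ≠ v → Γ.Adj v a →
      Commute (raagGen Γ v ^ (p a).1 * raagGen Γ a * raagGen Γ v ^ (p a).2)
        (raagGen Γ v ^ (p b).1 * raagGen Γ b * raagGen Γ v ^ (p b).2) := by
    intro a b hab hbv hva
    have h0 := hp2 a (fun ha => h.not_adj_rep ha.1 (ha.2 ▸ hva)) ⟨b, hbv, hab⟩
    have : raagGen Γ v ^ (p a).1 * raagGen Γ a * raagGen Γ v ^ (p a).2 = raagGen Γ a := by
      rw [(hcen a hva _).eq, mul_assoc, ← zpow_add, h0, zpow_zero, mul_one]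
    rw [this]
    exact ((hcen a hva _).symm.mul_right (raagGen_commute hab)).mul_right (hcen a hva _).symm
  have keyv : ∀ b, Γ.Adj v b → Commute (raagGen Γ v)
        (raagGen Γ v ^ (p b).1 * raagGen Γ b * raagGen Γ v ^ (p b).2) := fun b hvb =>
    (((Commute.refl _).zpow_right _).mul_right (raagGen_commute hvb)).mul_right
      ((Commute.refl _).zpow_right _)
  by_cases hxv : x = v
  · subst hxv
    simpa [hp1] using keyv y hxy
  by_cases hyv : y = v
  · subst hyv
    simpa [hp1] using (keyv x hxy.symm).symm
  by_cases hvx : Γ.Adj v x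
  · exact key x y hxy hyv hvx
  by_cases hvy : Γ.Adj v y
  · exact (key y x hxy.symm hxv hvy).symm
  have hx' : ¬ (x ∉ V0 ∧ c x = v) := fun hx => hvy (hx.2 ▸ h.adj_rep hx.1 hxy)
  have hy' : ¬ (y ∉ V0 ∧ c y = v) := fun hy => hvx (hy.2 ▸ h.adj_rep hy.1 hxy.symm)
  obtain ⟨C, hC, hxC⟩ := exists_isComponentOf Γ (S := {v}ᶜ) (x := x) hxv
  have heq := hp3 C hC x hxC y (hC.mem_of_adj hxC hxy hyv) hx' hy'
  have h0 := hp2 x hx' ⟨y, hyv, hxy⟩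
  have h1 : (p x).1 = -(p x).2 := by linarith
  rw [← heq, h1, zpow_neg]
  have := (raagGen_commute hxy).map (MulAut.conj (raagGen Γ v ^ (p x).2)⁻¹)
  simpa only [MonoidHom.coe_coe, MulAut.conj_apply, inv_inv] using this

lemma sum_eq_zero_of_mem_twists (h : IsMaximalSystem Γ V0 c) {v : V} {p : V → ℤ × ℤ}
    (hp : p ∈ twists Γ V0 c v) {x : V} (hx : x ∈ V0) : (p x).1 + (p x).2 = 0 := by
  by_cases hy : ∃ y, y ≠ v ∧ Γ.Adj x y
  · exact hp.2.1 x (fun hx' => hx'.1 hx) hy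
  · push Not at hy
    exact absurd hx (h.leaf_notMem fun y hxy => by_contra fun hne => hy y hne hxy)

/-- The endomorphism `x ↦ v ^ (p x).1 * x * v ^ (p x).2`. -/
def twistHom [Finite V] (h : IsMaximalSystem Γ V0 c) (v : V) (p : twists Γ V0 c v) :
    RAAG Γ →* RAAG Γ :=
  raagLift (fun x => raagGen Γ v ^ (p.1 x).1 * raagGen Γ x * raagGen Γ v ^ (p.1 x).2)
    fun _ _ hxy => twists_commute h p.2 hxy

lemma twistHom_gen [Finite V] (h : IsMaximalSystem Γ V0 c) (v : V) (p : twists Γ V0 c v) (x : V) :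
    twistHom h v p (raagGen Γ x) =
      raagGen Γ v ^ (p.1 x).1 * raagGen Γ x * raagGen Γ v ^ (p.1 x).2 :=
  raagLift_gen _ _ _

lemma twistHom_self [Finite V] (h : IsMaximalSystem Γ V0 c) (v : V) (p : twists Γ V0 c v) :
    twistHom h v p (raagGen Γ v) = raagGen Γ v := by
  rw [twistHom_gen, p.2.1]
  simp

lemma twistHom_add [Finite V] (h : IsMaximalSystem Γ V0 c) (v : V) (p q : twists Γ V0 c v) :
    twistHom h v (p + q) = (twistHom h v p).comp (twistHom h v q) := by
  refine raagHom_ext fun x => ?_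
  simp only [MonoidHom.comp_apply]
  rw [twistHom_gen, twistHom_gen]
  simp only [map_mul, map_zpow, twistHom_self, AddSubgroup.coe_add, Pi.add_apply, Prod.fst_add,
    Prod.snd_add]
  rw [twistHom_gen, add_comm (p.1 x).1, zpow_add, zpow_add]
  simp only [mul_assoc]

lemma twistHom_zero [Finite V] (h : IsMaximalSystem Γ V0 c) (v : V) :
    twistHom h v (0 : twists Γ V0 c v) = MonoidHom.id _ := by
  refine raagHom_ext fun x => ?_
  rw [twistHom_gen]
  simp

/-- The homomorphism sending `p` to the automorphism `x ↦ v ^ (p x).1 * x * v ^ (p x).2`. -/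
def twistAut [Finite V] (h : IsMaximalSystem Γ V0 c) (v : V) :
    Multiplicative (twists Γ V0 c v) →* MulAut (RAAG Γ) where
  toFun p := MonoidHom.toMulEquiv (twistHom h v p.toAdd) (twistHom h v (-p.toAdd))
    (by rw [← twistHom_add, neg_add_cancel, twistHom_zero])
    (by rw [← twistHom_add, add_neg_cancel, twistHom_zero])
  map_one' := by
    refine MulEquiv.toMonoidHom_injective ?_
    exact twistHom_zero h v
  map_mul' p q := by
    refine MulEquiv.toMonoidHom_injective ?_
    exact twistHom_add h v p.toAdd q.toAdd

lemma twistAut_gen [Finite V] (h : IsMaximalSystem Γ V0 c) (v : V)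
    (p : Multiplicative (twists Γ V0 c v)) (x : V) :
    twistAut h v p (raagGen Γ x) =
      raagGen Γ v ^ (p.toAdd.1 x).1 * raagGen Γ x * raagGen Γ v ^ (p.toAdd.1 x).2 :=
  twistHom_gen h v p.toAdd x

/-- The action of `twistAut` depends only on the values of `p` away from the star of `v`, and
on the total exponents at the vertices adjacent to `v`. -/
lemma twistAut_congr [Finite V] (h : IsMaximalSystem Γ V0 c) {v : V}
    {p q : Multiplicative (twists Γ V0 c v)}
    (hsum : ∀ x, Γ.Adj v x → (p.toAdd.1 x).1 + (p.toAdd.1 x).2 = (q.toAdd.1 x).1 + (q.toAdd.1 x).2)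
    (heq : ∀ x, x ≠ v → ¬ Γ.Adj v x → p.toAdd.1 x = q.toAdd.1 x) :
    twistAut h v p = twistAut h v q := by
  refine raagAut_ext fun x => ?_
  rw [twistAut_gen, twistAut_gen]
  by_cases hxv : x = v
  · subst hxv
    rw [p.toAdd.2.1, q.toAdd.2.1]
  by_cases hvx : Γ.Adj v x
  · have hc : ∀ k : ℤ, raagGen Γ v ^ k * raagGen Γ x = raagGen Γ x * raagGen Γ v ^ k := fun k =>
      ((raagGen_commute hvx).zpow_left k).eq
    rw [hc, hc, mul_assoc, mul_assoc, ← zpow_add, ← zpow_add, hsum x hvx]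
  · rw [heq x hxv hvx]

/-- The exponents of the conjugation by `v` of all vertices in `C`. -/
def conjExp (C : Set V) : V → ℤ × ℤ := by
  classical exact fun x => if x ∈ C then (-1, 1) else 0

lemma conjExp_of_mem {C : Set V} {x : V} (hx : x ∈ C) : conjExp C x = (-1, 1) := by
  simp [conjExp, hx]

lemma conjExp_of_notMem {C : Set V} {x : V} (hx : x ∉ C) : conjExp C x = 0 := by
  simp [conjExp, hx]

lemma conjExp_sum (C : Set V) (x : V) : (conjExp C x).1 + (conjExp C x).2 = 0 := by
  by_cases hx : x ∈ C
  · simp [conjExp_of_mem hx]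
  · simp [conjExp_of_notMem hx]

lemma conjExp_component_mem {v : V} {C : Set V} (hC : IsComponentOf Γ ({v}ᶜ : Set V) C) :
    conjExp C ∈ twists Γ V0 c v := by
  refine ⟨conjExp_of_notMem fun hv => hC.ne hv rfl, fun x _ _ => conjExp_sum C x, ?_⟩
  intro D hD x hx y hy _ _
  by_cases hxC : x ∈ C
  · rw [conjExp_of_mem hxC, conjExp_of_mem ((hC.eq hD hxC hx) ▸ hy)]
  · have hyC : y ∉ C := fun hyC => hxC ((hC.eq hD hyC hy) ▸ hx)
    rw [conjExp_of_notMem hxC, conjExp_of_notMem hyC]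

lemma conjExp_compl_mem {v : V} : conjExp ({v}ᶜ : Set V) ∈ twists Γ V0 c v := by
  refine ⟨conjExp_of_notMem (by simp), fun x _ _ => conjExp_sum _ x, ?_⟩
  intro D hD x hx y hy _ _
  rw [conjExp_of_mem (hD.1 hx), conjExp_of_mem (hD.1 hy)]

/-- The exponents of conjugation by `v`. -/
def fullConj (Γ : SimpleGraph V) (V0 : Finset V) (c : V → V) (v : V) : twists Γ V0 c v :=
  ⟨conjExp {v}ᶜ, conjExp_compl_mem⟩

lemma twistAut_fullConj [Finite V] (h : IsMaximalSystem Γ V0 c) (v : V) :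
    twistAut h v (Multiplicative.ofAdd (fullConj Γ V0 c v)) = MulAut.conj (raagGen Γ v)⁻¹ := by
  refine raagAut_ext fun x => ?_
  rw [twistAut_gen]
  by_cases hx : x = v
  · subst hx
    simp [fullConj, conjExp]
  · simp [fullConj, conjExp, hx]

end Twist

/-! ### Commutation in the outer automorphism group -/

section Commutation

variable {Γ : SimpleGraph V} {V0 : Finset V} {c : V → V}

lemma eq_zero_or_eq_zero_or_adj [Finite V] (h : IsMaximalSystem Γ V0 c) {u v : V} (hu : u ∈ V0)
    (hv : v ∈ V0) (huv : u ≠ v) {p q : V → ℤ × ℤ} (hp : p ∈ twists Γ V0 c u)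
    (hq : q ∈ twists Γ V0 c v) (hpv : p v = 0) (hqu : q u = 0) (x : V) :
    p x = 0 ∨ q x = 0 ∨ Γ.Adj u v := by
  by_contra! hcon
  obtain ⟨hpx, hqx, hadj⟩ := hcon
  have hxu : x ≠ u := by
    rintro rfl
    exact hpx hp.1
  have hxv : x ≠ v := by
    rintro rfl
    exact hqx hq.1
  obtain ⟨C, hC, hxC⟩ := exists_isComponentOf Γ (S := {u}ᶜ) (x := x) hxu
  obtain ⟨D, hD, hxD⟩ := exists_isComponentOf Γ (S := {v}ᶜ) (x := x) hxv
  by_cases hxXu : x ∉ V0 ∧ c x = u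
  · obtain ⟨y, hxy⟩ := h.exists_adj x
    have huy : Γ.Adj u y := hxXu.2 ▸ h.adj_rep hxXu.1 hxy
    have hyv : y ≠ v := by
      rintro rfl
      exact hadj huy
    have huD : u ∈ D := hD.mem_of_adj (hD.mem_of_adj hxD hxy hyv) huy.symm huv
    exact hqx ((hq.2.2 D hD x hxD u huD (fun hx => huv (hxXu.2.symm.trans hx.2))
      (fun hx => hx.1 hu)).trans hqu)
  by_cases hxXv : x ∉ V0 ∧ c x = v
  · obtain ⟨y, hxy⟩ := h.exists_adj x
    have hvy : Γ.Adj v y := hxXv.2 ▸ h.adj_rep hxXv.1 hxy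
    have hyu : y ≠ u := by
      rintro rfl
      exact hadj hvy.symm
    have hvC : v ∈ C := hC.mem_of_adj (hC.mem_of_adj hxC hxy hyu) hvy.symm huv.symm
    exact hpx ((hp.2.2 C hC x hxC v hvC hxXu (fun hx => hx.1 hv)).trans hpv)
  rcases mem_component_or_mem_component h.connected huv hC hD hxC hxD with hvC | huD
  · exact hpx ((hp.2.2 C hC x hxC v hvC hxXu (fun hx => hx.1 hv)).trans hpv)
  · exact hqx ((hq.2.2 D hD x hxD u huD hxXv (fun hx => hx.1 hu)).trans hqu)

lemma twistAut_commute [Finite V] (h : IsMaximalSystem Γ V0 c) {u v : V} (hu : u ∈ V0)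
    (hv : v ∈ V0) (huv : u ≠ v) {p : Multiplicative (twists Γ V0 c u)}
    {q : Multiplicative (twists Γ V0 c v)} (hpv : p.toAdd.1 v = 0) (hqu : q.toAdd.1 u = 0) :
    Commute (twistAut h u p) (twistAut h v q) := by
  refine raagAut_ext fun x => ?_
  have h1 : twistAut h u p (raagGen Γ v) = raagGen Γ v := by
    rw [twistAut_gen, hpv]
    simp
  have h2 : twistAut h v q (raagGen Γ u) = raagGen Γ u := by
    rw [twistAut_gen, hqu]
    simp
  simp only [MulAut.mul_apply]
  rw [twistAut_gen h v, twistAut_gen h u]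
  simp only [map_mul, map_zpow, h1, h2]
  rw [twistAut_gen h v, twistAut_gen h u]
  rcases eq_zero_or_eq_zero_or_adj h hu hv huv p.toAdd.2 q.toAdd.2 hpv hqu x with h0 | h0 | hadj
  · simp [h0]
  · simp [h0]
  · have hc : ∀ k l : ℤ, Commute (raagGen Γ u ^ k) (raagGen Γ v ^ l) := fun k l =>
      ((raagGen_commute hadj).zpow_left k).zpow_right l
    have e1 := (hc (p.toAdd.1 x).1 (q.toAdd.1 x).1).eq
    have e2 := (hc (p.toAdd.1 x).2 (q.toAdd.1 x).2).eq
    simp only [mul_assoc]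
    rw [e2, ← mul_assoc, ← e1, mul_assoc]

/-- The outer class of `twistAut`. -/
def twistOut [Finite V] (h : IsMaximalSystem Γ V0 c) (v : V) :
    Multiplicative (twists Γ V0 c v) →* Out (RAAG Γ) :=
  (QuotientGroup.mk' (Inn (RAAG Γ))).comp (twistAut h v)

lemma twistOut_apply [Finite V] (h : IsMaximalSystem Γ V0 c) (v : V)
    (p : Multiplicative (twists Γ V0 c v)) :
    twistOut h v p = QuotientGroup.mk' (Inn (RAAG Γ)) (twistAut h v p) := rfl

lemma twistOut_fullConj [Finite V] (h : IsMaximalSystem Γ V0 c) (v : V) :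
    twistOut h v (Multiplicative.ofAdd (fullConj Γ V0 c v)) = 1 := by
  rw [twistOut_apply, twistAut_fullConj, QuotientGroup.mk'_apply, QuotientGroup.eq_one_iff]
  exact ⟨_, rfl⟩

lemma exists_twistOut_eq [Finite V] (h : IsMaximalSystem Γ V0 c) {u v : V} (hv : v ∈ V0)
    (huv : u ≠ v) (p : Multiplicative (twists Γ V0 c u)) :
    ∃ p' : Multiplicative (twists Γ V0 c u), twistOut h u p' = twistOut h u p ∧
      p'.toAdd.1 v = 0 := by
  refine ⟨p * (Multiplicative.ofAdd (fullConj Γ V0 c u)) ^ (-(p.toAdd.1 v).2), ?_, ?_⟩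
  · rw [map_mul, map_zpow, twistOut_fullConj, one_zpow, mul_one]
  · have h0 := sum_eq_zero_of_mem_twists h p.toAdd.2 hv
    have hv' : conjExp ({u}ᶜ : Set V) v = (-1, 1) := conjExp_of_mem (by simpa using huv.symm)
    simp only [toAdd_mul, toAdd_zpow, toAdd_ofAdd, AddSubgroup.coe_add, AddSubgroup.coe_zsmul,
      Pi.add_apply, Pi.smul_apply, fullConj, hv']
    ext <;> simp
    linarith

lemma twistOut_commute [Finite V] (h : IsMaximalSystem Γ V0 c) {u v : V} (hu : u ∈ V0)
    (hv : v ∈ V0) (huv : u ≠ v) (p : Multiplicative (twists Γ V0 c u))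
    (q : Multiplicative (twists Γ V0 c v)) :
    Commute (twistOut h u p) (twistOut h v q) := by
  obtain ⟨p', hp', hpv⟩ := exists_twistOut_eq h hv huv p
  obtain ⟨q', hq', hqu⟩ := exists_twistOut_eq h hu huv.symm q
  rw [← hp', ← hq']
  exact (twistAut_commute h hu hv huv hpv hqu).map (QuotientGroup.mk' (Inn (RAAG Γ)))

/-- The product of the outer classes of `twistAut` over the vertices in `V0`. -/
def twistProd [Finite V] (h : IsMaximalSystem Γ V0 c) :
    (∀ v : V0, Multiplicative (twists Γ V0 c v)) →* Out (RAAG Γ) :=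
  MonoidHom.noncommPiCoprod (fun v : V0 => twistOut h v) fun u v huv p q =>
    twistOut_commute h u.2 v.2 (fun he => huv (Subtype.ext he)) p q

open Classical in
lemma twistProd_mulSingle [Finite V] (h : IsMaximalSystem Γ V0 c) (v : V0)
    (p : Multiplicative (twists Γ V0 c v)) :
    twistProd h (Pi.mulSingle v p) = twistOut h v p :=
  MonoidHom.noncommPiCoprod_mulSingle _ _ _

end Commutation

/-! ### Detecting exponents in abelian and Heisenberg quotients -/

/-- The integral Heisenberg group. -/
@[ext]
structure Heisenberg where
  /-- first exponent -/
  fst : ℤ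
  /-- second exponent -/
  snd : ℤ
  /-- central coordinate -/
  corner : ℤ

namespace Heisenberg

instance : Mul Heisenberg := ⟨fun g k => ⟨g.fst + k.fst, g.snd + k.snd,
  g.corner + k.corner + g.fst * k.snd⟩⟩

instance : One Heisenberg := ⟨⟨0, 0, 0⟩⟩

instance : Inv Heisenberg := ⟨fun g => ⟨-g.fst, -g.snd, -g.corner + g.fst * g.snd⟩⟩

@[simp] lemma fst_mul (g k : Heisenberg) : (g * k).fst = g.fst + k.fst := rfl
@[simp] lemma snd_mul (g k : Heisenberg) : (g * k).snd = g.snd + k.snd := rfl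
@[simp] lemma corner_mul (g k : Heisenberg) :
    (g * k).corner = g.corner + k.corner + g.fst * k.snd := rfl
@[simp] lemma fst_one : (1 : Heisenberg).fst = 0 := rfl
@[simp] lemma snd_one : (1 : Heisenberg).snd = 0 := rfl
@[simp] lemma corner_one : (1 : Heisenberg).corner = 0 := rfl
@[simp] lemma fst_inv (g : Heisenberg) : g⁻¹.fst = -g.fst := rfl
@[simp] lemma snd_inv (g : Heisenberg) : g⁻¹.snd = -g.snd := rfl
@[simp] lemma corner_inv (g : Heisenberg) : g⁻¹.corner = -g.corner + g.fst * g.snd := rfl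

instance : Group Heisenberg := Group.ofLeftAxioms
  (fun a b d => by ext <;> simp <;> ring)
  (fun a => by ext <;> simp)
  (fun a => by ext <;> simp)

lemma fst_zpow (g : Heisenberg) (k : ℤ) : (g ^ k).fst = k * g.fst := by
  induction k using Int.induction_on with
  | zero => simp
  | succ n ih => rw [zpow_add_one, fst_mul, ih]; ring
  | pred n ih => rw [zpow_sub_one, fst_mul, ih, fst_inv]; ring

lemma snd_zpow (g : Heisenberg) (k : ℤ) : (g ^ k).snd = k * g.snd := by
  induction k using Int.induction_on with
  | zero => simp
  | succ n ih => rw [zpow_add_one, snd_mul, ih]; ring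
  | pred n ih => rw [zpow_sub_one, snd_mul, ih, snd_inv]; ring

lemma corner_zpow {g : Heisenberg} (hg : g.fst = 0) (k : ℤ) : (g ^ k).corner = k * g.corner := by
  induction k using Int.induction_on with
  | zero => simp
  | succ n ih => rw [zpow_add_one, corner_mul, ih, fst_zpow, hg]; ring
  | pred n ih => rw [zpow_sub_one, corner_mul, ih, fst_zpow, corner_inv, hg]; ring

lemma corner_zpow_mul_zpow {g k : Heisenberg} (hg : g.fst = 0) (hk : k.fst = 1) (m n : ℤ)
    (hmn : (m + n) * g.corner = 0) :
    (g ^ m * k * g ^ n).corner = k.corner + n * g.snd := by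
  simp only [corner_mul, fst_mul, corner_zpow hg, fst_zpow, snd_zpow, hg, hk]
  linear_combination hmn

end Heisenberg

section Exponents

variable {Γ : SimpleGraph V}

open Classical in
/-- The exponent sum of the generator `y`. -/
def expSum (Γ : SimpleGraph V) (y : V) : RAAG Γ →* Multiplicative ℤ :=
  raagLift (fun x => Multiplicative.ofAdd (if x = y then (1 : ℤ) else 0)) fun _ _ _ =>
    Commute.all _ _

lemma expSum_self (y : V) : (expSum Γ y (raagGen Γ y)).toAdd = 1 := by
  simp [expSum]

lemma expSum_of_ne {x y : V} (hxy : x ≠ y) : (expSum Γ y (raagGen Γ x)).toAdd = 0 := by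
  simp [expSum, hxy]

/-- The quotient onto the Heisenberg group sending two nonadjacent vertices to the standard
generators and killing all others. -/
def toHeisenberg {x v : V} (hne : x ≠ v) (hxv : ¬ Γ.Adj v x) : RAAG Γ →* Heisenberg := by
  classical exact raagLift (fun y => if y = x then ⟨1, 0, 0⟩ else if y = v then ⟨0, 1, 0⟩ else 1) (by
    intro a b hab
    by_cases hax : a = x
    · have hbx : b ≠ x := fun hb => hab.ne (hax.trans hb.symm)
      have hbv : b ≠ v := by
        rintro rfl
        exact hxv (hax ▸ hab.symm)
      simp only [hbx, hbv, if_false]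
      exact Commute.one_right _
    by_cases hbx : b = x
    · have hav : a ≠ v := by
        rintro rfl
        exact hxv (hbx ▸ hab)
      simp only [hax, hav, if_false]
      exact Commute.one_left _
    by_cases hav : a = v
    · have hbv : b ≠ v := fun hb => hab.ne (hav.trans hb.symm)
      simp only [hbx, hbv, if_false]
      exact Commute.one_right _
    · simp only [hax, hav, if_false]
      exact Commute.one_left _)

lemma toHeisenberg_gen_corner {x v : V} (hne : x ≠ v) (hxv : ¬ Γ.Adj v x) (y : V) :
    (toHeisenberg hne hxv (raagGen Γ y)).corner = 0 := by
  simp only [toHeisenberg, raagLift_gen]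
  split_ifs <;> rfl

lemma toHeisenberg_fst {x v : V} (hne : x ≠ v) (hxv : ¬ Γ.Adj v x) (g : RAAG Γ) :
    (toHeisenberg hne hxv g).fst = (expSum Γ x g).toAdd := by
  let f : Heisenberg →* Multiplicative ℤ :=
    { toFun := fun g => Multiplicative.ofAdd g.fst
      map_one' := rfl
      map_mul' := fun _ _ => rfl }
  have : f.comp (toHeisenberg hne hxv) = expSum Γ x := raagHom_ext fun y => by
    simp only [MonoidHom.comp_apply, toHeisenberg, expSum, raagLift_gen]
    split_ifs <;> rfl
  exact congrArg Multiplicative.toAdd (DFunLike.congr_fun this g)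

lemma toHeisenberg_snd {x v : V} (hne : x ≠ v) (hxv : ¬ Γ.Adj v x) (g : RAAG Γ) :
    (toHeisenberg hne hxv g).snd = (expSum Γ v g).toAdd := by
  let f : Heisenberg →* Multiplicative ℤ :=
    { toFun := fun g => Multiplicative.ofAdd g.snd
      map_one' := rfl
      map_mul' := fun _ _ => rfl }
  have : f.comp (toHeisenberg hne hxv) = expSum Γ v := raagHom_ext fun y => by
    simp only [MonoidHom.comp_apply, toHeisenberg, expSum, raagLift_gen]
    by_cases hyx : y = x
    · subst hyx
      simp [hne, f]
    · by_cases hyv : y = v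
      · subst hyv
        simp [hyx, f]
      · simp [hyx, hyv, f]
  exact congrArg Multiplicative.toAdd (DFunLike.congr_fun this g)

end Exponents

section Tracking

variable {Γ : SimpleGraph V} {V0 : Finset V} {c : V → V}

/-- The automorphism `φ` acts on the abelian and Heisenberg quotients as the product of the
automorphisms `twistAut` with exponents `p`. -/
structure Tracks (φ : MulAut (RAAG Γ)) (p : ∀ v : V0, Multiplicative (twists Γ V0 c v)) :
    Prop where
  expSum_rep : ∀ (x : V) (v : V0), x ≠ v →
    (expSum Γ v (φ (raagGen Γ x))).toAdd = ((p v).toAdd.1 x).1 + ((p v).toAdd.1 x).2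
  expSum_self : ∀ x : V, (expSum Γ x (φ (raagGen Γ x))).toAdd = 1
  expSum_of_ne : ∀ (u : V0) (y : V), y ≠ u → (expSum Γ y (φ (raagGen Γ u))).toAdd = 0
  corner_rep : ∀ (u v : V0) (x : V), x ∉ V0 → ∀ (hne : x ≠ v) (hxv : ¬ Γ.Adj v x),
    (toHeisenberg hne hxv (φ (raagGen Γ u))).corner = 0
  corner : ∀ (v : V0) (x : V) (hne : x ≠ v) (hxv : ¬ Γ.Adj v x),
    (toHeisenberg hne hxv (φ (raagGen Γ x))).corner = ((p v).toAdd.1 x).2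

lemma Tracks.one : Tracks (1 : MulAut (RAAG Γ))
    (1 : ∀ v : V0, Multiplicative (twists Γ V0 c v)) where
  expSum_rep x v hx := by simpa using _root_.expSum_of_ne hx
  expSum_self x := by simpa using _root_.expSum_self x
  expSum_of_ne u y hy := by simpa using _root_.expSum_of_ne hy.symm
  corner_rep u v x _ hne hxv := by simpa using toHeisenberg_gen_corner hne hxv u
  corner v x hne hxv := by simpa using toHeisenberg_gen_corner hne hxv x

open Classical in
lemma Tracks.mul [Finite V] (h : IsMaximalSystem Γ V0 c) {φ : MulAut (RAAG Γ)}
    {p : ∀ v : V0, Multiplicative (twists Γ V0 c v)} (hφ : Tracks φ p) (u : V0)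
    (q : Multiplicative (twists Γ V0 c u)) :
    Tracks (φ * twistAut h u q) (p * Pi.mulSingle u q) := by
  have hgen : ∀ x, (φ * twistAut h u q) (raagGen Γ x) = φ (raagGen Γ u) ^ (q.toAdd.1 x).1 *
      φ (raagGen Γ x) * φ (raagGen Γ u) ^ (q.toAdd.1 x).2 := fun x => by
    rw [MulAut.mul_apply, twistAut_gen, map_mul, map_mul, map_zpow, map_zpow]
  have hexp : ∀ x y, (expSum Γ y ((φ * twistAut h u q) (raagGen Γ x))).toAdd =
      ((q.toAdd.1 x).1 + (q.toAdd.1 x).2) * (expSum Γ y (φ (raagGen Γ u))).toAdd +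
        (expSum Γ y (φ (raagGen Γ x))).toAdd := fun x y => by
    rw [hgen]
    simp only [map_mul, map_zpow, toAdd_mul, toAdd_zpow, smul_eq_mul]
    ring
  have hrep : ∀ w : V0, (q.toAdd.1 w).1 + (q.toAdd.1 w).2 = 0 := fun w =>
    sum_eq_zero_of_mem_twists h q.toAdd.2 w.2
  have hsingle : ∀ (v : V0) (x : V),
      ((p * (Pi.mulSingle u q : ∀ v : V0, Multiplicative (twists Γ V0 c v))) v).toAdd.1 x =
      (p v).toAdd.1 x + if u = v then q.toAdd.1 x else 0 := by
    intro v x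
    by_cases huv : u = v
    · subst huv
      simp
    · simp [huv]
  constructor
  · intro x v hx
    rw [hexp, hφ.expSum_rep x v hx, hsingle]
    by_cases huv : u = v
    · subst huv
      rw [hφ.expSum_self]
      simp only [if_true, Prod.fst_add, Prod.snd_add]
      ring
    · rw [hφ.expSum_of_ne u v (fun he => huv (Subtype.ext he.symm))]
      simp [huv]
  · intro x
    rw [hexp, hφ.expSum_self]
    by_cases hx : x = u
    · rw [hx, q.toAdd.2.1]
      simp
    · rw [hφ.expSum_of_ne u x hx]
      simp
  · intro w y hy
    rw [hexp, hφ.expSum_of_ne w y hy, hrep]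
    simp
  · intro w v x hx hne hxv
    have hfst : ∀ w : V0, (toHeisenberg hne hxv (φ (raagGen Γ w))).fst = 0 := fun w => by
      rw [toHeisenberg_fst]
      exact hφ.expSum_of_ne w x (fun he => hx (he ▸ w.2))
    rw [hgen]
    simp only [map_mul, map_zpow, Heisenberg.corner_mul, Heisenberg.fst_mul,
      Heisenberg.corner_zpow (hfst u), Heisenberg.fst_zpow, hfst,
      hφ.corner_rep _ v x hx hne hxv]
    simp
  · intro v x hne hxv
    rw [hsingle]
    by_cases hx : x = u
    · rw [hgen]
      have h0 : q.toAdd.1 x = 0 := hx ▸ q.toAdd.2.1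
      simp [h0, hφ.corner v x hne hxv]
    · have hfst : (toHeisenberg hne hxv (φ (raagGen Γ u))).fst = 0 := by
        rw [toHeisenberg_fst]
        exact hφ.expSum_of_ne u x hx
      have hfst' : (toHeisenberg hne hxv (φ (raagGen Γ x))).fst = 1 := by
        rw [toHeisenberg_fst]
        exact hφ.expSum_self x
      have hzero : ((q.toAdd.1 x).1 + (q.toAdd.1 x).2) *
          (toHeisenberg hne hxv (φ (raagGen Γ u))).corner = 0 := by
        by_cases hxV : x ∈ V0
        · rw [hrep ⟨x, hxV⟩, zero_mul]
        · rw [hφ.corner_rep u v x hxV hne hxv, mul_zero]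
      rw [hgen]
      simp only [map_mul, map_zpow]
      rw [Heisenberg.corner_zpow_mul_zpow hfst hfst' _ _ hzero, hφ.corner v x hne hxv,
        toHeisenberg_snd]
      by_cases huv : u = v
      · subst huv
        rw [hφ.expSum_self]
        simp
      · rw [hφ.expSum_of_ne u v (fun he => huv (Subtype.ext he.symm))]
        simp [huv]

lemma exists_tracks [Finite V] (h : IsMaximalSystem Γ V0 c)
    (p : ∀ v : V0, Multiplicative (twists Γ V0 c v)) :
    ∃ φ : MulAut (RAAG Γ), QuotientGroup.mk' (Inn (RAAG Γ)) φ = twistProd h p ∧ Tracks φ p := by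
  classical
  have key : ∀ s : Finset V0, ∃ φ : MulAut (RAAG Γ), QuotientGroup.mk' (Inn (RAAG Γ)) φ =
      twistProd h (∏ v ∈ s, Pi.mulSingle v (p v)) ∧ Tracks φ (∏ v ∈ s, Pi.mulSingle v (p v)) := by
    intro s
    induction s using Finset.induction_on with
    | empty => exact ⟨1, by simp, by simpa using Tracks.one⟩
    | insert u s hu ih =>
      obtain ⟨φ, hφ, ht⟩ := ih
      have hmul : ∏ v ∈ insert u s, (Pi.mulSingle v (p v) :
          ∀ v : V0, Multiplicative (twists Γ V0 c v)) =
            (∏ v ∈ s, Pi.mulSingle v (p v)) * Pi.mulSingle u (p u) := by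
        rw [Finset.prod_insert hu]
        exact mul_comm _ _
      refine ⟨φ * twistAut h u (p u), ?_, ?_⟩
      · rw [hmul, map_mul, map_mul, hφ, twistProd_mulSingle, twistOut_apply]
      · rw [hmul]
        exact ht.mul h u (p u)
  simpa only [Finset.univ_prod_mulSingle] using key Finset.univ

/-- If the product of twists is trivial in the outer automorphism group, then it is the product of
conjugations by the vertices in `V0`. -/
lemma eq_of_twistProd_eq_one [Finite V] (h : IsMaximalSystem Γ V0 c)
    {p : ∀ v : V0, Multiplicative (twists Γ V0 c v)} (hp : twistProd h p = 1) (v : V0) :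
    (∀ x : V, ((p v).toAdd.1 x).1 + ((p v).toAdd.1 x).2 = 0) ∧
      ∃ m : ℤ, ∀ x : V, x ≠ v → ¬ Γ.Adj v x → ((p v).toAdd.1 x).2 = m := by
  obtain ⟨φ, hφ, ht⟩ := exists_tracks h p
  rw [hp, QuotientGroup.mk'_apply, QuotientGroup.eq_one_iff] at hφ
  obtain ⟨g, rfl⟩ := hφ
  refine ⟨fun x => ?_, -(expSum Γ v g).toAdd, fun x hne hxv => ?_⟩
  · by_cases hx : x = v
    · rw [hx, (p v).toAdd.2.1]
      simp
    · rw [← ht.expSum_rep x v hx]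
      simp [MulAut.conj_apply, expSum_of_ne hx]
  · rw [← ht.corner v x hne hxv]
    simp only [MulAut.conj_apply, map_mul, map_inv, Heisenberg.corner_mul, Heisenberg.fst_mul,
      Heisenberg.corner_inv, Heisenberg.snd_inv, toHeisenberg_gen_corner, toHeisenberg_fst,
      toHeisenberg_snd, expSum_self, expSum_of_ne hne]
    ring

end Tracking

/-! ### Linear combinations of generating exponents -/

section Combination

variable {Γ : SimpleGraph V} {V0 : Finset V} {c : V → V}

lemma twistProd_congr [Finite V] (h : IsMaximalSystem Γ V0 c)
    {p q : ∀ v : V0, Multiplicative (twists Γ V0 c v)}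
    (hpq : ∀ v : V0, twistOut h v (p v) = twistOut h v (q v)) : twistProd h p = twistProd h q := by
  exact Finset.noncommProd_congr rfl (fun v _ => hpq v) fun u _ v _ huv =>
    twistOut_commute h u.2 v.2 (fun he => huv (Subtype.ext he)) _ _

/-- The exponents attached to a component which is not a twig: a right transvection if the
component is a single leaf, and a conjugation otherwise. -/
def compExp (C : Set V) (x : V) : ℤ × ℤ := by
  classical exact if ∃ w, C = {w} then (if x ∈ C then (0, 1) else 0) else conjExp C x

lemma compExp_singleton_self (w : V) : compExp {w} w = (0, 1) := by
  simp [compExp]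

lemma compExp_of_mem {C : Set V} (hC : ¬ ∃ w, C = {w}) {x : V} (hx : x ∈ C) :
    compExp C x = (-1, 1) := by
  simp [compExp, hC, conjExp_of_mem hx]

lemma compExp_of_notMem {C : Set V} {x : V} (hx : x ∉ C) : compExp C x = 0 := by
  simp [compExp, hx, conjExp_of_notMem hx]

open Classical in
lemma single_mem_twists {v w : V} (hwv : w ≠ v) (a : ℤ × ℤ)
    (hw : (w ∉ V0 ∧ c w = v) ∨ IsComponentOf Γ ({v}ᶜ : Set V) {w}) :
    (Pi.single w a : V → ℤ × ℤ) ∈ twists Γ V0 c v := by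
  refine ⟨by simp [hwv.symm], ?_, ?_⟩
  · rintro x hx ⟨y, hyv, hxy⟩
    by_cases hxw : x = w
    · subst hxw
      rcases hw with hw | hw
      · exact absurd hw hx
      · have := hw.mem_of_adj rfl hxy hyv
        exact absurd hxy (this ▸ Γ.irrefl)
    · simp [hxw]
  · intro C hC x hx y hy hxw hyw
    rcases hw with hw | hw
    · have hx' : x ≠ w := by
        rintro rfl
        exact hxw hw
      have hy' : y ≠ w := by
        rintro rfl
        exact hyw hw
      simp [hx', hy']
    · by_cases hxw : x = w
      · have hyw : y = w := by
          have := hC.eq hw hx hxw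
          subst this
          exact hy
        rw [hxw, hyw]
      · have hyw : y ≠ w := by
          intro hyw
          have := hC.eq hw hy hyw
          subst this
          exact hxw hx
        simp [hxw, hyw]

open Classical in
lemma compExp_mem {v : V} {C : Set V} (hC : IsComponentOf Γ ({v}ᶜ : Set V) C) :
    compExp C ∈ twists Γ V0 c v := by
  by_cases hs : ∃ w, C = {w}
  · obtain ⟨w, rfl⟩ := hs
    have : compExp {w} = (Pi.single w (0, 1) : V → ℤ × ℤ) := by
      funext x
      by_cases hx : x = w
      · subst hx
        simp [compExp_singleton_self]
      · simp [hx, compExp_of_notMem (C := {w}) (x := x) hx]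
    rw [this]
    exact single_mem_twists (hC.ne rfl) _ (Or.inr hC)
  · have : compExp C = conjExp C := by
      funext x
      simp [compExp, hs]
    rw [this]
    exact conjExp_component_mem hC

/-- A vertex of `V0` together with a component of its complement that is not a twig. -/
abbrev ComponentIndex (Γ : SimpleGraph V) (V0 : Finset V) :=
  Σ v : V0, {C : Set V // IsComponentOf Γ ({v.1}ᶜ : Set V) C ∧ ¬ IsTwigOf Γ v C}

/-- The index type of the generators: left transvections, right transvections, and leaf
transvections or partial conjugations. -/
abbrev TwistIndex (Γ : SimpleGraph V) (V0 : Finset V) :=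
  {x : V // x ∉ V0} ⊕ {x : V // x ∉ V0} ⊕ ComponentIndex Γ V0

/-- The vertex whose powers are used by a generator. -/
def indexVertex (h : IsMaximalSystem Γ V0 c) : TwistIndex Γ V0 → V0
  | .inl x => ⟨c x, h.rep_mem x x.2⟩
  | .inr (.inl x) => ⟨c x, h.rep_mem x x.2⟩
  | .inr (.inr s) => s.1

open Classical in
/-- The exponents of a generator. -/
def indexExp : TwistIndex Γ V0 → V → ℤ × ℤ
  | .inl x => Pi.single x.1 (1, 0)
  | .inr (.inl x) => Pi.single x.1 (0, 1)
  | .inr (.inr s) => compExp s.2.1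

lemma indexExp_mem (h : IsMaximalSystem Γ V0 c) (i : TwistIndex Γ V0) :
    indexExp i ∈ twists Γ V0 c (indexVertex h i) := by
  rcases i with x | x | s
  · exact single_mem_twists (h.rep_ne x.2).symm _ (Or.inl ⟨x.2, rfl⟩)
  · exact single_mem_twists (h.rep_ne x.2).symm _ (Or.inl ⟨x.2, rfl⟩)
  · exact compExp_mem s.2.2.1

open Classical in
/-- The exponents of a generator, as a family indexed by `V0`. -/
def twistBasis (h : IsMaximalSystem Γ V0 c) (i : TwistIndex Γ V0) (v : V0) : twists Γ V0 c v :=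
  ⟨if indexVertex h i = v then indexExp i else 0, by
    split_ifs with hi
    · exact hi ▸ indexExp_mem h i
    · exact zero_mem _⟩

open Classical in
/-- The product of powers of the generators. -/
def combination [Fintype V] (h : IsMaximalSystem Γ V0 c) :
    (TwistIndex Γ V0 → ℤ) →+ ∀ v : V0, twists Γ V0 c v where
  toFun n v := ∑ i, n i • twistBasis h i v
  map_zero' := by
    funext v
    simp
  map_add' m n := by
    funext v
    simp [add_smul, Finset.sum_add_distrib]

open Classical in
lemma combination_apply [Fintype V] (h : IsMaximalSystem Γ V0 c) (n : TwistIndex Γ V0 → ℤ)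
    (v : V0) (x : V) : (combination h n v).1 x =
      ∑ i, n i • if indexVertex h i = v then indexExp i x else 0 := by
  simp only [combination, AddMonoidHom.coe_mk, ZeroHom.coe_mk, AddSubgroup.val_finsetSum,
    AddSubgroup.coe_zsmul, Finset.sum_apply, Pi.smul_apply, twistBasis]
  refine Finset.sum_congr rfl fun i _ => ?_
  split_ifs <;> rfl

lemma combination_eq_zero [Fintype V] (h : IsMaximalSystem Γ V0 c) {n : TwistIndex Γ V0 → ℤ}
    {v : V0} (hn : ∀ i, indexVertex h i = v → n i = 0) : combination h n v = 0 := by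
  refine Subtype.ext (funext fun x => ?_)
  rw [combination_apply]
  refine Finset.sum_eq_zero fun i _ => ?_
  by_cases hi : indexVertex h i = v
  · rw [hn i hi, zero_smul]
  · rw [if_neg hi, smul_zero]

open Classical in
/-- The contribution of the transvections to the exponents of a combination. -/
def repPart (c : V → V) (n : TwistIndex Γ V0 → ℤ) (v x : V) : ℤ × ℤ :=
  if hx : x ∉ V0 ∧ c x = v then (n (.inl ⟨x, hx.1⟩), n (.inr (.inl ⟨x, hx.1⟩))) else 0

open Classical in
/-- The contribution of the components to the exponents of a combination. -/
def compPart [Fintype V] (n : ComponentIndex Γ V0 → ℤ) (v : V0) (x : V) : ℤ × ℤ :=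
  ∑ s, n s • if s.1 = v then compExp s.2.1 x else 0

lemma combination_eq_add [Fintype V] (h : IsMaximalSystem Γ V0 c) (n : TwistIndex Γ V0 → ℤ)
    (v : V0) (x : V) : (combination h n v).1 x =
      repPart c n v x + compPart (fun s => n (.inr (.inr s))) v x := by
  classical
  have hsum : ∀ (f : {x : V // x ∉ V0} → ℤ) (a : ℤ × ℤ),
      (∑ y, f y • if (⟨c y.1, h.rep_mem y.1 y.2⟩ : V0) = v then
        (Pi.single y.1 a : V → ℤ × ℤ) x else 0) =
      if hx : x ∉ V0 ∧ c x = v then f ⟨x, hx.1⟩ • a else 0 := by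
    intro f a
    split_ifs with hx
    · rw [Finset.sum_eq_single ⟨x, hx.1⟩]
      · simp [hx.2]
      · intro y _ hy
        have : x ≠ y.1 := fun he => hy (Subtype.ext he.symm)
        simp [this]
      · simp
    · refine Finset.sum_eq_zero fun y _ => ?_
      by_cases hxy : x = y.1
      · subst hxy
        have : c y.1 ≠ v := fun he => hx ⟨y.2, he⟩
        simp [this, Subtype.ext_iff]
      · simp [hxy]
  rw [combination_apply, Fintype.sum_sum_type, Fintype.sum_sum_type, ← add_assoc]
  congr 1
  refine (congrArg₂ (· + ·) (hsum (fun y => n (.inl y)) (1, 0))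
    (hsum (fun y => n (.inr (.inl y))) (0, 1))).trans ?_
  rw [repPart]
  split_ifs <;> simp

lemma compPart_of_mem [Fintype V] (n : ComponentIndex Γ V0 → ℤ) (s : ComponentIndex Γ V0) {x : V}
    (hx : x ∈ s.2.1) : compPart n s.1 x = n s • compExp s.2.1 x := by
  classical
  rw [compPart, Finset.sum_eq_single s]
  · simp
  · rintro ⟨u, D, hD⟩ _ hne
    by_cases hu : u = s.1
    · subst hu
      have hxD : x ∉ D := by
        intro hxD
        have hDs : D = s.2.1 := hD.1.eq s.2.2.1 hxD hx
        subst hDs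
        exact hne rfl
      simp [compExp_of_notMem hxD]
    · simp [hu]
  · simp

lemma compPart_of_twig [Fintype V] (n : ComponentIndex Γ V0 → ℤ) (v : V0) {C : Set V}
    (hC : IsTwigOf Γ v C) {x : V} (hx : x ∈ C) : compPart n v x = 0 := by
  refine Finset.sum_eq_zero ?_
  rintro ⟨u, D, hD⟩ _
  by_cases hu : u = v
  · subst hu
    have hxD : x ∉ D := by
      intro hxD
      have hDC : D = C := hD.1.eq hC.1 hxD hx
      subst hDC
      exact hD.2 hC
    simp [compExp_of_notMem hxD]
  · simp [hu]

lemma repPart_of_rep (n : TwistIndex Γ V0 → ℤ) (x : {x : V // x ∉ V0}) :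
    repPart c n (c x) x = (n (.inl x), n (.inr (.inl x))) := by
  simp [repPart, x.2]

lemma repPart_of_not (n : TwistIndex Γ V0 → ℤ) {v x : V} (hx : ¬ (x ∉ V0 ∧ c x = v)) :
    repPart c n v x = 0 := by
  rw [repPart, dif_neg hx]

/-- The product of powers of the generators, in the outer automorphism group. -/
def combinationOut [Fintype V] (h : IsMaximalSystem Γ V0 c) :
    Multiplicative (TwistIndex Γ V0 → ℤ) →* Out (RAAG Γ) where
  toFun n := twistProd h fun v => Multiplicative.ofAdd (combination h n.toAdd v)
  map_one' := by
    rw [toAdd_one, map_zero]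
    exact map_one (twistProd h)
  map_mul' m n := by
    rw [toAdd_mul, map_add, ← map_mul]
    rfl

lemma combinationOut_apply [Fintype V] (h : IsMaximalSystem Γ V0 c) (n : TwistIndex Γ V0 → ℤ) :
    combinationOut h (Multiplicative.ofAdd n) =
      twistProd h fun v => Multiplicative.ofAdd (combination h n v) := rfl

open Classical in
lemma combinationOut_eq_twistOut [Fintype V] (h : IsMaximalSystem Γ V0 c)
    {n : TwistIndex Γ V0 → ℤ} {v : V0} (hn : ∀ i, indexVertex h i ≠ v → n i = 0)
    {p : twists Γ V0 c v} (hp : twistOut h v (Multiplicative.ofAdd (combination h n v)) =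
      twistOut h v (Multiplicative.ofAdd p)) :
    combinationOut h (Multiplicative.ofAdd n) = twistOut h v (Multiplicative.ofAdd p) := by
  rw [combinationOut_apply, ← twistProd_mulSingle h v]
  refine twistProd_congr h fun u => ?_
  by_cases hu : u = v
  · subst hu
    rw [Pi.mulSingle_eq_same, hp]
  · rw [Pi.mulSingle_eq_of_ne hu, combination_eq_zero h fun i hi => hn i (hi ▸ hu)]
    rfl

open Classical in
lemma combinationOut_single [Fintype V] (h : IsMaximalSystem Γ V0 c) (i : TwistIndex Γ V0) :
    combinationOut h (Multiplicative.ofAdd (Pi.single i 1)) =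
      twistOut h (indexVertex h i) (Multiplicative.ofAdd ⟨indexExp i, indexExp_mem h i⟩) := by
  refine combinationOut_eq_twistOut h (fun j hj => ?_) ?_
  · have : j ≠ i := fun he => hj (he ▸ rfl)
    simp [this]
  · congr 2
    refine Subtype.ext (funext fun x => ?_)
    rw [combination_apply, Finset.sum_eq_single i]
    · simp
    · intro j _ hj
      simp [hj]
    · simp

end Combination

/-! ### The kernel of the map to the outer automorphism group -/

section Kernel

variable {Γ : SimpleGraph V} {V0 : Finset V} {c : V → V}

lemma not_rep_of_adj (h : IsMaximalSystem Γ V0 c) {v x : V} (hvx : Γ.Adj v x) :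
    ¬ (x ∉ V0 ∧ c x = v) := fun hx => h.not_adj_rep hx.1 (hx.2 ▸ hvx)

lemma twistOut_combination_eq [Fintype V] (h : IsMaximalSystem Γ V0 c) {n : TwistIndex Γ V0 → ℤ}
    {v : V0} {p : twists Γ V0 c v}
    (hrep : ∀ x, x ∉ V0 → c x = v → (combination h n v).1 x = p.1 x)
    (hleaf : ∀ w hw, n (.inr (.inr ⟨v, {w}, hw⟩)) = (p.1 w).1 + (p.1 w).2)
    (hbranch : ∀ C hC, (¬ ∃ w, C = {w}) → ∀ x ∈ C, ¬ (x ∉ V0 ∧ c x = v) →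
      n (.inr (.inr ⟨v, C, hC⟩)) • (-1, 1) = p.1 x) :
    twistOut h v (Multiplicative.ofAdd (combination h n v)) =
      twistOut h v (Multiplicative.ofAdd p) := by
  rw [twistOut_apply, twistOut_apply]
  refine congrArg _ (twistAut_congr h (fun x hvx => ?_) fun x hxv hvx => ?_)
  · have hx := not_rep_of_adj h hvx
    simp only [toAdd_ofAdd]
    by_cases hy : ∃ y : V, y ≠ v ∧ Γ.Adj x y
    · rw [(combination h n v).2.2.1 x hx hy, p.2.2.1 x hx hy]
    · push Not at hy
      have hC : IsComponentOf Γ ({v.1}ᶜ : Set V) {x} := isComponentOf_singleton hvx.ne'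
        fun y hxy => by_contra fun hne => hy y hne hxy
      have ht : ¬ IsTwigOf Γ v {x} := fun ht => ht.2.1 ⟨x, rfl⟩
      rw [combination_eq_add, repPart_of_not _ hx,
        compPart_of_mem _ ⟨v, {x}, hC, ht⟩ (Set.mem_singleton x), compExp_singleton_self,
        ← hleaf x ⟨hC, ht⟩]
      simp
  · simp only [toAdd_ofAdd]
    by_cases hx : x ∉ V0 ∧ c x = v
    · exact hrep x hx.1 hx.2
    obtain ⟨C, hC, hxC⟩ := exists_isComponentOf Γ (S := {v.1}ᶜ) (x := x) hxv
    have hs : ¬ ∃ w, C = {w} := by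
      rintro ⟨w, rfl⟩
      obtain rfl : x = w := hxC
      exact hvx (h.adj_of_singleton hC).1.symm
    have ht : ¬ IsTwigOf Γ v C := fun ht => hx (h.rep_eq_of_twig v.2 ht hxC hvx)
    rw [combination_eq_add, repPart_of_not _ hx, compPart_of_mem _ ⟨v, C, hC, ht⟩ hxC,
      compExp_of_mem hs hxC, zero_add]
    exact hbranch C ⟨hC, ht⟩ hs x hxC hx

/-- Every twist is a product of powers of the generators in the outer automorphism group. -/
lemma exists_combinationOut_eq [Fintype V] (h : IsMaximalSystem Γ V0 c) (v : V0)
    (p : twists Γ V0 c v) : ∃ n : TwistIndex Γ V0 → ℤ,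
      combinationOut h (Multiplicative.ofAdd n) = twistOut h v (Multiplicative.ofAdd p) := by
  classical
  have hk : ∀ C : Set V, ∃ k : ℤ, (∀ w, C = {w} → k = (p.1 w).1 + (p.1 w).2) ∧
      (IsComponentOf Γ ({v.1}ᶜ : Set V) C ∧ ¬ IsTwigOf Γ v C → (¬ ∃ w, C = {w}) →
        ∀ x ∈ C, ¬ (x ∉ V0 ∧ c x = v) → k • (-1, 1) = p.1 x) := by
    intro C
    by_cases hs : ∃ w, C = {w}
    · obtain ⟨w, rfl⟩ := hs
      refine ⟨(p.1 w).1 + (p.1 w).2, fun w' hw' => ?_, fun _ hs => absurd ⟨w, rfl⟩ hs⟩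
      rw [Set.singleton_injective hw']
    by_cases hC : IsComponentOf Γ ({v.1}ᶜ : Set V) C ∧ ¬ IsTwigOf Γ v C
    · obtain ⟨y, hy, hyV, -⟩ := h.exists_mem_of_branch hC.1 hs hC.2
      refine ⟨(p.1 y).2, fun w hw => absurd ⟨w, hw⟩ hs, fun _ _ x hx hxV => ?_⟩
      rw [p.2.2.2 C hC.1 x hx y hy hxV fun h' => h'.1 hyV]
      have h0 := sum_eq_zero_of_mem_twists h p.2 hyV
      ext
      · simp
        linarith
      · simp
    · exact ⟨0, fun w hw => absurd ⟨w, hw⟩ hs, fun hC' => absurd hC' hC⟩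
  choose k hk1 hk2 using hk
  let m : ComponentIndex Γ V0 → ℤ := fun s => if s.1 = v then k s.2.1 else 0
  let n : TwistIndex Γ V0 → ℤ
    | .inl x => if c x = v then (p.1 x).1 - (compPart m v x).1 else 0
    | .inr (.inl x) => if c x = v then (p.1 x).2 - (compPart m v x).2 else 0
    | .inr (.inr s) => m s
  refine ⟨n, combinationOut_eq_twistOut h ?_ (twistOut_combination_eq h ?_ ?_ ?_)⟩
  · rintro (x | x | s) hi
    · exact if_neg fun he => hi (Subtype.ext he)
    · exact if_neg fun he => hi (Subtype.ext he)
    · exact if_neg hi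
  · intro x hx hxv
    rw [combination_eq_add, repPart, dif_pos ⟨hx, hxv⟩]
    change (_, _) + compPart m v x = _
    simp only [n, hxv, if_true]
    ext <;> simp
  · intro w hw
    simp only [n, m, if_true]
    exact hk1 _ w rfl
  · intro C hC hs x hx hxV
    simp only [n, m, if_true]
    exact hk2 C hC hs x hx hxV

open Classical in
/-- The coefficients expressing the conjugations by vertices in terms of the generators. -/
def conjCoeff (c : V → V) : TwistIndex Γ V0 → ℤ
  | .inl x => if ∃ C, IsTwigOf Γ (c x) C ∧ x.1 ∈ C then -1 else 0
  | .inr (.inl x) => if ∃ C, IsTwigOf Γ (c x) C ∧ x.1 ∈ C then 1 else 0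
  | .inr (.inr s) => if ∃ w, s.2.1 = {w} then 0 else 1

lemma conjCoeff_of_twig {x : {x : V // x ∉ V0}} {C : Set V} (hC : IsTwigOf Γ (c x) C)
    (hx : x.1 ∈ C) : conjCoeff c (.inl x : TwistIndex Γ V0) = -1 ∧
      conjCoeff c (.inr (.inl x) : TwistIndex Γ V0) = 1 :=
  ⟨if_pos ⟨C, hC, hx⟩, if_pos ⟨C, hC, hx⟩⟩

lemma conjCoeff_of_not_twig {x : {x : V // x ∉ V0}} {C : Set V}
    (hC : IsComponentOf Γ ({c x}ᶜ : Set V) C) (hx : x.1 ∈ C) (ht : ¬ IsTwigOf Γ (c x) C) :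
    conjCoeff c (.inl x : TwistIndex Γ V0) = 0 ∧
      conjCoeff c (.inr (.inl x) : TwistIndex Γ V0) = 0 := by
  have : ¬ ∃ D, IsTwigOf Γ (c x) D ∧ x.1 ∈ D := by
    rintro ⟨D, hD, hxD⟩
    exact ht (hC.eq hD.1 hx hxD ▸ hD)
  exact ⟨if_neg this, if_neg this⟩

lemma not_singleton_of_not_adj (h : IsMaximalSystem Γ V0 c) {v x : V} {C : Set V}
    (hC : IsComponentOf Γ ({v}ᶜ : Set V) C) (hx : x ∈ C) (hvx : ¬ Γ.Adj v x) :
    ¬ ∃ w, C = {w} := by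
  rintro ⟨w, rfl⟩
  obtain rfl : x = w := hx
  exact hvx (h.adj_of_singleton hC).1.symm

lemma combinationOut_conjCoeff [Fintype V] (h : IsMaximalSystem Γ V0 c) (m : V0 → ℤ) :
    combinationOut h (Multiplicative.ofAdd fun i => m (indexVertex h i) * conjCoeff c i) = 1 := by
  rw [combinationOut_apply, ← map_one (twistProd h)]
  refine twistProd_congr h fun v => ?_
  have hconj : twistOut h v (Multiplicative.ofAdd (m v • fullConj Γ V0 c v)) = 1 := by
    rw [ofAdd_zsmul, map_zpow, twistOut_fullConj, one_zpow]
  rw [Pi.one_apply, map_one, ← hconj]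
  have hval : ∀ x : V, x ≠ v → (m v • fullConj Γ V0 c v).1 x = (-m v, m v) := by
    intro x hx
    simp [fullConj, conjExp, hx]
  refine twistOut_combination_eq h ?_ ?_ ?_
  · intro x hx hxv
    obtain ⟨v, hv⟩ := v
    obtain rfl : c x = v := hxv
    have hne : x ≠ c x := (h.rep_ne hx).symm
    rw [hval x hne, combination_eq_add, repPart_of_rep _ ⟨x, hx⟩]
    obtain ⟨C, hC, hxC⟩ := exists_isComponentOf Γ (S := {c x}ᶜ) (x := x) hne
    by_cases ht : IsTwigOf Γ (c x) C
    · obtain ⟨h1, h2⟩ := conjCoeff_of_twig (x := ⟨x, hx⟩) ht hxC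
      rw [compPart_of_twig _ ⟨c x, hv⟩ ht hxC, h1, h2]
      simp [indexVertex]
    · have hs := not_singleton_of_not_adj h hC hxC (h.not_adj_rep hx)
      obtain ⟨h1, h2⟩ := conjCoeff_of_not_twig (x := ⟨x, hx⟩) hC hxC ht
      rw [compPart_of_mem _ ⟨⟨c x, hv⟩, C, hC, ht⟩ hxC, compExp_of_mem hs hxC, h1, h2]
      simp [conjCoeff, indexVertex, hs]
  · intro w hw
    rw [hval w (hw.1.ne rfl)]
    simp [conjCoeff]
  · intro C hC hs x hx hxV
    rw [hval x (hC.1.ne hx)]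
    simp [conjCoeff, hs, indexVertex]

lemma exists_of_combinationOut_eq_one [Fintype V] (h : IsMaximalSystem Γ V0 c)
    {n : TwistIndex Γ V0 → ℤ} (hn : combinationOut h (Multiplicative.ofAdd n) = 1) :
    ∃ m : V0 → ℤ, n = fun i => m (indexVertex h i) * conjCoeff c i := by
  rw [combinationOut_apply] at hn
  have hsum := fun v => (eq_of_twistProd_eq_one h hn v).1
  choose m hm using fun v => (eq_of_twistProd_eq_one h hn v).2
  simp only [toAdd_ofAdd] at hsum hm
  have hbranch : ∀ s : ComponentIndex Γ V0, (¬ ∃ w, s.2.1 = {w}) →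
      n (.inr (.inr s)) = m s.1 := by
    rintro ⟨v, C, hC⟩ hs
    obtain ⟨x, hx, hxV, hvx⟩ := h.exists_mem_of_branch hC.1 hs hC.2
    rw [← hm v x (hC.1.ne hx) hvx, combination_eq_add, repPart_of_not _ fun hx => hx.1 hxV,
      compPart_of_mem _ ⟨v, C, hC⟩ hx, compExp_of_mem hs hx]
    simp
  have hrep : ∀ x : {x : V // x ∉ V0},
      n (.inl x) = m ⟨c x, h.rep_mem x x.2⟩ * conjCoeff c (.inl x : TwistIndex Γ V0) ∧
      n (.inr (.inl x)) =
        m ⟨c x, h.rep_mem x x.2⟩ * conjCoeff c (.inr (.inl x) : TwistIndex Γ V0) := by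
    rintro ⟨x, hx⟩
    have hne : x ≠ c x := (h.rep_ne hx).symm
    have hadj := h.not_adj_rep hx
    obtain ⟨C, hC, hxC⟩ := exists_isComponentOf Γ (S := {c x}ᶜ) (x := x) hne
    have h1 := hsum ⟨c x, h.rep_mem x hx⟩ x
    have h2 := hm ⟨c x, h.rep_mem x hx⟩ x hne hadj
    rw [combination_eq_add, repPart_of_rep _ ⟨x, hx⟩] at h1 h2
    by_cases ht : IsTwigOf Γ (c x) C
    · rw [compPart_of_twig _ ⟨c x, h.rep_mem x hx⟩ ht hxC] at h1 h2
      simp only [add_zero] at h1 h2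
      obtain ⟨h3, h4⟩ := conjCoeff_of_twig (x := ⟨x, hx⟩) ht hxC
      rw [h3, h4]
      constructor <;> linarith
    · have hs := not_singleton_of_not_adj h hC hxC hadj
      rw [compPart_of_mem _ ⟨⟨c x, h.rep_mem x hx⟩, C, hC, ht⟩ hxC, compExp_of_mem hs hxC,
        hbranch _ hs] at h1 h2
      simp only [Prod.snd_add, Prod.fst_add, Prod.smul_mk, smul_eq_mul] at h1 h2
      obtain ⟨h3, h4⟩ := conjCoeff_of_not_twig (x := ⟨x, hx⟩) hC hxC ht
      rw [h3, h4]
      constructor <;> linarith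
  refine ⟨m, funext ?_⟩
  rintro (x | x | s)
  · exact (hrep x).1
  · exact (hrep x).2
  · by_cases hs : ∃ w, s.2.1 = {w}
    · obtain ⟨v, C, hC⟩ := s
      obtain ⟨w, rfl⟩ := hs
      have hvw := (h.adj_of_singleton hC.1).1.symm
      have h1 := hsum v w
      rw [combination_eq_add, repPart_of_not _ (not_rep_of_adj h hvw),
        compPart_of_mem _ ⟨v, {w}, hC⟩ (Set.mem_singleton w), compExp_singleton_self] at h1
      simpa [conjCoeff] using h1
    · rw [hbranch s hs]
      simp [conjCoeff, hs, indexVertex]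

lemma exists_conjCoeff_eq_one [Finite V] (h : IsMaximalSystem Γ V0 c) (v : V0) :
    ∃ i : TwistIndex Γ V0, indexVertex h i = v ∧ conjCoeff c i = 1 := by
  obtain ⟨C, hC, hs⟩ := h.exists_nonsingleton_component v
  by_cases ht : IsTwigOf Γ v C
  · obtain ⟨x, hx, hvx⟩ : ∃ x ∈ C, ¬ Γ.Adj v x := by
      by_contra! hall
      obtain ⟨x, hx⟩ := hC.2.1
      have hxall : ∀ y, Γ.Adj x y → y = v := fun y hxy => by_contra fun hy =>
        h.not_adj (hall x hx) hxy (hall y (hC.mem_of_adj hx hxy hy))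
      exact hs ⟨x, hC.eq (isComponentOf_singleton (hC.ne hx) hxall) hx rfl⟩
    obtain ⟨hxV, hcx⟩ := h.rep_eq_of_twig v.2 ht hx hvx
    refine ⟨.inr (.inl ⟨x, hxV⟩), Subtype.ext hcx, if_pos ⟨C, ?_, hx⟩⟩
    exact hcx.symm ▸ ht
  · exact ⟨.inr (.inr ⟨v, C, hC, ht⟩), rfl, if_neg hs⟩

end Kernel

/-! ### The subgroup generated by transvections and partial conjugations -/

section Generation

variable {Γ : SimpleGraph V} {V0 : Finset V} {c : V → V}

/-- The left and right transvections `v ↦ c(v)v` and `v ↦ vc(v)`, the leaf transvections and the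
partial conjugations. -/
def generators (Γ : SimpleGraph V) (V0 : Finset V) (c : V → V) : Set (MulAut (RAAG Γ)) :=
  {φ : MulAut (RAAG Γ) | ∃ v, v ∉ V0 ∧
      (IsLeftTransvection Γ φ v (c v) ∨ IsTransvection Γ φ v (c v))} ∪
    {φ : MulAut (RAAG Γ) | ∃ w v, IsLeaf Γ w ∧ Γ.Adj v w ∧ IsTransvection Γ φ w v} ∪
    {φ : MulAut (RAAG Γ) | ∃ v C, IsComponentOf Γ ({v}ᶜ : Set V) C ∧ IsPartialConjBy Γ φ v C}

open Classical in
lemma mk_mem_range_combinationOut [Fintype V] (h : IsMaximalSystem Γ V0 c) {φ : MulAut (RAAG Γ)}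
    (i : TwistIndex Γ V0) (hφ : ∀ x, φ (raagGen Γ x) =
      raagGen Γ (indexVertex h i) ^ (indexExp i x).1 * raagGen Γ x *
        raagGen Γ (indexVertex h i) ^ (indexExp i x).2) :
    QuotientGroup.mk' (Inn (RAAG Γ)) φ ∈ (combinationOut h).range := by
  refine ⟨_, (combinationOut_single h i).trans ?_⟩
  rw [twistOut_apply]
  refine congrArg _ (raagAut_ext fun x => ?_)
  rw [twistAut_gen, hφ]
  rfl

lemma mk_mem_range_of_mem_generators [Fintype V] (h : IsMaximalSystem Γ V0 c)
    {φ : MulAut (RAAG Γ)} (hφ : φ ∈ generators Γ V0 c) :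
    QuotientGroup.mk' (Inn (RAAG Γ)) φ ∈ (combinationOut h).range := by
  classical
  obtain (⟨v, hv, ⟨-, -, h1, h2⟩ | ⟨-, -, h1, h2⟩⟩ | ⟨w, v, ⟨u, hu⟩, hvw, -, -, h1, h2⟩) |
    ⟨v, C, hC, h1, h2⟩ := hφ
  · refine mk_mem_range_combinationOut h (.inl ⟨v, hv⟩) fun x => ?_
    by_cases hx : x = v
    · subst hx
      simp [indexExp, indexVertex, h1]
    · simp [indexExp, h2 x hx, hx]
  · refine mk_mem_range_combinationOut h (.inr (.inl ⟨v, hv⟩)) fun x => ?_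
    by_cases hx : x = v
    · subst hx
      simp [indexExp, indexVertex, h1]
    · simp [indexExp, h2 x hx, hx]
  · have hw : ∀ y, Γ.Adj w y → y = u := fun y hy => by
      have : y ∈ Γ.neighborSet w := hy
      rwa [hu] at this
    obtain rfl := hw v hvw.symm
    have hv : v ∈ V0 := by
      by_contra hv
      exact h.rep_ne hv (hw _ (h.adj_rep hv hvw).symm)
    have ht : ¬ IsTwigOf Γ v {w} := fun ht => ht.2.1 ⟨w, rfl⟩
    refine mk_mem_range_combinationOut h
      (.inr (.inr ⟨⟨v, hv⟩, {w}, isComponentOf_singleton hvw.ne' hw, ht⟩)) fun x => ?_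
    by_cases hx : x = w
    · subst hx
      simp [indexExp, indexVertex, h1, compExp_singleton_self]
    · simp [indexExp, h2 x hx, compExp_of_notMem (C := {w}) (x := x) hx]
  · by_cases hv : v ∈ V0
    · obtain ⟨n, hn⟩ := exists_combinationOut_eq h ⟨v, hv⟩ ⟨conjExp C, conjExp_component_mem hC⟩
      refine ⟨Multiplicative.ofAdd n, hn.trans ?_⟩
      rw [twistOut_apply]
      refine congrArg _ (raagAut_ext fun x => ?_)
      rw [twistAut_gen]
      by_cases hx : x ∈ C
      · simp [conjExp_of_mem hx, h1 x hx]
      · simp [conjExp_of_notMem hx, h2 x hx]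
    · have : φ = MulAut.conj (raagGen Γ v)⁻¹ := by
        refine raagAut_ext fun x => ?_
        by_cases hx : x = v
        · subst hx
          rw [h2 x fun hxC => hC.ne hxC rfl]
          simp
        · rw [h1 x (h.eq_compl_of_notMem hv hC ▸ hx)]
          simp
      have h0 : QuotientGroup.mk' (Inn (RAAG Γ)) φ = 1 := by
        rw [QuotientGroup.mk'_apply, QuotientGroup.eq_one_iff]
        exact ⟨_, this.symm⟩
      rw [h0]
      exact one_mem _

lemma twistAut_indexExp_mem_generators [Finite V] (h : IsMaximalSystem Γ V0 c)
    (i : TwistIndex Γ V0) : twistAut h (indexVertex h i)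
      (Multiplicative.ofAdd ⟨indexExp i, indexExp_mem h i⟩) ∈ generators Γ V0 c := by
  have hgen := twistAut_gen h (indexVertex h i)
    (Multiplicative.ofAdd ⟨indexExp i, indexExp_mem h i⟩)
  simp only [toAdd_ofAdd] at hgen
  generalize twistAut h (indexVertex h i) _ = φ at hgen
  rcases i with x | x | ⟨v, C, hC, ht⟩
  · refine Or.inl (Or.inl ⟨x.1, x.2, Or.inl ⟨h.rep_ne x.2, fun y hy => Or.inr (h.lk_rep _ x.2 hy),
      ?_, fun y hy => ?_⟩⟩)
    · rw [hgen]
      simp [indexExp, indexVertex]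
    · rw [hgen]
      simp [indexExp, hy]
  · refine Or.inl (Or.inl ⟨x.1, x.2, Or.inr ⟨h.rep_ne x.2, fun y hy => Or.inr (h.lk_rep _ x.2 hy),
      ?_, fun y hy => ?_⟩⟩)
    · rw [hgen]
      simp [indexExp, indexVertex]
    · rw [hgen]
      simp [indexExp, hy]
  · by_cases hs : ∃ w, C = {w}
    · obtain ⟨w, rfl⟩ := hs
      obtain ⟨hwv, hw⟩ := h.adj_of_singleton hC
      have hnbr : Γ.neighborSet w = {v.1} :=
        Set.Subset.antisymm (fun y hy => hw y hy) (Set.singleton_subset_iff.2 hwv)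
      refine Or.inl (Or.inr ⟨w, v, ⟨v, hnbr⟩, hwv.symm, hwv.ne', fun y hy => Or.inl (hw y hy),
        ?_, fun y hy => ?_⟩)
      · rw [hgen]
        simp [indexExp, indexVertex, compExp_singleton_self]
      · rw [hgen]
        simp [indexExp, compExp_of_notMem (C := {w}) (x := y) hy]
    · refine Or.inr ⟨v, C, hC, fun x hx => ?_, fun x hx => ?_⟩
      · rw [hgen]
        simp [indexExp, indexVertex, compExp_of_mem hs hx]
      · rw [hgen]
        simp [indexExp, compExp_of_notMem hx]

lemma map_closure_generators [Fintype V] (h : IsMaximalSystem Γ V0 c) :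
    (Subgroup.closure (generators Γ V0 c)).map (QuotientGroup.mk' (Inn (RAAG Γ))) =
      (combinationOut h).range := by
  classical
  apply le_antisymm
  · rw [Subgroup.map_le_iff_le_comap, Subgroup.closure_le]
    exact fun φ hφ => mk_mem_range_of_mem_generators h hφ
  · rw [MonoidHom.range_eq_map, Subgroup.map_le_iff_le_comap]
    rintro n -
    have hn : n = ∏ i, Multiplicative.ofAdd (Pi.single i 1 : TwistIndex Γ V0 → ℤ) ^ n.toAdd i := by
      apply Multiplicative.toAdd.injective
      rw [toAdd_prod]
      funext j
      simp [Finset.sum_apply, Pi.single_apply]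
    rw [hn]
    refine Subgroup.prod_mem _ fun i _ => Subgroup.zpow_mem _ ?_ _
    rw [Subgroup.mem_comap, combinationOut_single]
    exact Subgroup.mem_map_of_mem _
      (Subgroup.subset_closure (twistAut_indexExp_mem_generators h i))

end Generation

/-! ### Counting the rank -/

section Rank

lemma exists_mulEquiv_range {I J H : Type*} [Finite I] [Finite J] [Group H]
    (F : Multiplicative (I → ℤ) →* H) (f : I → J) (r : I → ℤ)
    (hker : ∀ n, F (Multiplicative.ofAdd n) = 1 ↔ ∃ m : J → ℤ, n = fun i => m (f i) * r i)
    (hr : ∀ j, ∃ i, f i = j ∧ r i = 1) :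
    ∃ k : ℕ, k + Nat.card J = Nat.card I ∧
      Nonempty (F.range ≃* Multiplicative (Fin k → ℤ)) := by
  classical
  choose s hs hrs using hr
  have hsinj : Function.Injective s := Function.LeftInverse.injective hs
  let T := {i : I // i ∉ Set.range s}
  let E : (T → ℤ) →+ (I → ℤ) :=
    { toFun := fun n i => if hi : i ∉ Set.range s then n ⟨i, hi⟩ else 0
      map_zero' := by
        funext i
        simp
      map_add' := fun m n => by
        funext i
        simp only [Pi.add_apply]
        split_ifs <;> rfl }
  have hEs : ∀ n j, E n (s j) = 0 := fun n j => by simp [E]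
  have hET : ∀ n (t : T), E n t.1 = n t := fun n t => dif_pos t.2
  let F' : Multiplicative (T → ℤ) →* H := F.comp (AddMonoidHom.toMultiplicative E)
  have hinj : Function.Injective F' := by
    rw [injective_iff_map_eq_one]
    intro n hn
    obtain ⟨m, hm⟩ := (hker (E n.toAdd)).1 hn
    have hm0 : ∀ j, m j = 0 := fun j => by
      have := congrFun hm (s j)
      simpa [hEs, hs, hrs] using this.symm
    apply Multiplicative.toAdd.injective
    funext t
    have := congrFun hm t.1
    rw [hET] at this
    simpa [hm0] using this
  have hrange : F'.range = F.range := by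
    apply le_antisymm
    · rintro _ ⟨n, rfl⟩
      exact ⟨_, rfl⟩
    · rintro _ ⟨n, rfl⟩
      let n' : I → ℤ := fun i => n.toAdd (s (f i)) * r i
      refine ⟨Multiplicative.ofAdd fun t => n.toAdd t.1 - n' t.1, ?_⟩
      have hE : E (fun t => n.toAdd t.1 - n' t.1) = n.toAdd - n' := by
        funext i
        by_cases hi : i ∉ Set.range s
        · exact hET _ ⟨i, hi⟩
        · push Not at hi
          obtain ⟨j, rfl⟩ := hi
          rw [hEs]
          simp [n', hs, hrs]
      change F (Multiplicative.ofAdd (E fun t => n.toAdd t.1 - n' t.1)) = F n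
      rw [hE, ofAdd_sub, map_div, (hker n').2 ⟨fun j => n.toAdd (s j), rfl⟩, div_one]
      rfl
  refine ⟨Nat.card T, ?_, ⟨?_⟩⟩
  · have hsum := Nat.card_congr (Equiv.sumCompl fun i => i ∈ Set.range s)
    rw [Nat.card_sum] at hsum
    rw [← hsum, add_comm]
    congr 1
    exact (Nat.card_range_of_injective hsinj).symm
  · exact ((MulEquiv.subgroupCongr hrange).symm.trans (MonoidHom.ofInjective hinj).symm).trans
      (AddEquiv.toMultiplicative (AddEquiv.arrowCongr (Finite.equivFin T) (AddEquiv.refl ℤ)))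

lemma card_twistIndex [Fintype V] [DecidableEq V] (Γ : SimpleGraph V) (V0 : Finset V) :
    (Nat.card (TwistIndex Γ V0) : ℤ) = 2 * ((Finset.univ \ V0).card : ℤ) +
      ∑ v ∈ V0, ((deltaC Γ v : ℤ) - (nTwigs Γ v : ℤ)) := by
  have hX : Nat.card {x : V // x ∉ V0} = (Finset.univ \ V0).card := by
    rw [Nat.card_eq_fintype_card, Fintype.card_subtype]
    congr 1
    ext x
    simp
  have hcomp : ∀ v : V, (Nat.card {C : Set V // IsComponentOf Γ ({v}ᶜ : Set V) C ∧
      ¬ IsTwigOf Γ v C} : ℤ) = (deltaC Γ v : ℤ) - (nTwigs Γ v : ℤ) := by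
    intro v
    have hsub : {C : Set V | IsTwigOf Γ v C} ⊆ {C | IsComponentOf Γ ({v}ᶜ : Set V) C} :=
      fun C hC => hC.1
    have := Set.ncard_sdiff_add_ncard_of_subset hsub (Set.toFinite _)
    rw [deltaC, nTwigs, ← this]
    push_cast
    rw [add_sub_cancel_right]
    rfl
  rw [Nat.card_sum, Nat.card_sum, Nat.card_sigma, hX]
  push_cast
  simp only [hcomp]
  rw [Finset.sum_coe_sort V0 fun v => (deltaC Γ v : ℤ) - (nTwigs Γ v : ℤ)]
  ring

end Rank

lemma isMaximalSystem {Γ : SimpleGraph V} (hconn : Γ.Connected) (htf : Γ.CliqueFree 3)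
    (hnostar : ¬ ∃ v, IsStarGraph Γ v) {V0 : Finset V} (hV0 : IsV0 Γ V0) {c : V → V}
    (hc : ∀ v ∉ V0, c v ∈ V0 ∧ lk Γ v ⊆ lk Γ (c v)) : IsMaximalSystem Γ V0 c := by
  classical
  rcases hV0 with ⟨v, hv, -⟩ | ⟨-, hmax, huniq, -⟩
  · exact absurd ⟨v, hv⟩ hnostar
  · exact
      { connected := hconn
        not_adj := fun hxy hyz hxz =>
          htf _ (SimpleGraph.is3Clique_triple_iff.2 ⟨hxy, hxz, hyz⟩)
        not_star := hnostar
        maximal := hmax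
        unique := huniq
        rep_mem := fun v hv => (hc v hv).1
        lk_rep := fun v hv => (hc v hv).2 }


/-- The image `G` in `Out(A_Γ)` of the subgroup of `Aut(A_Γ)` generated by the
free abelian subgroups `A` (left and right transvections `v ↦ c(v)·v`, `v ↦ v·c(v)`
for `v ∉ V0`), `L` (leaf transvections) and `C` (partial conjugations by a vertex of
a single component of `Γ − {v}`) is free abelian of rank
`2|V∖V0| + Σ_{v∈V0}(δ_C(v) − τ(v) − 1)`. -/
theorem abelian_subgroup_rank {V : Type*} [Fintype V] [DecidableEq V]
    (Γ : SimpleGraph V)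
    (hconn : Γ.Connected) (htf : Γ.CliqueFree 3) (hE : 2 ≤ Γ.edgeSet.ncard)
    (hnostar : ¬ ∃ c, IsStarGraph Γ c)
    (V0 : Finset V) (hV0 : IsV0 Γ ↑V0)
    (c : V → V) (hc : ∀ v ∉ V0, c v ∈ V0 ∧ lk Γ v ⊆ lk Γ (c v)) :
    ∃ n : ℕ,
      (n : ℤ) = 2 * ((Finset.univ \ V0).card : ℤ) +
        ∑ v ∈ V0, ((deltaC Γ v : ℤ) - (nTwigs Γ v : ℤ) - 1) ∧
      Nonempty ((Subgroup.map (QuotientGroup.mk' (Inn (RAAG Γ)))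
          (Subgroup.closure
            ({φ : MulAut (RAAG Γ) | ∃ v, v ∉ V0 ∧
                (IsLeftTransvection Γ φ v (c v) ∨ IsTransvection Γ φ v (c v))} ∪
             {φ : MulAut (RAAG Γ) | ∃ w v, IsLeaf Γ w ∧ Γ.Adj v w ∧
                IsTransvection Γ φ w v} ∪
             {φ : MulAut (RAAG Γ) | ∃ v C, IsComponentOf Γ ({v}ᶜ : Set V) C ∧
                IsPartialConjBy Γ φ v C})))
        ≃* Multiplicative (Fin n → ℤ)) := by
  have h := isMaximalSystem hconn htf hnostar hV0 hc
  obtain ⟨k, hk, ⟨e⟩⟩ := exists_mulEquiv_range (combinationOut h) (indexVertex h) (conjCoeff c)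
    (fun n => ⟨exists_of_combinationOut_eq_one h, by
      rintro ⟨m, rfl⟩
      exact combinationOut_conjCoeff h m⟩) (exists_conjCoeff_eq_one h)
  refine ⟨k, ?_, ⟨(MulEquiv.subgroupCongr (map_closure_generators h)).trans e⟩⟩
  have hcard := card_twistIndex Γ V0
  rw [← hk, Nat.card_eq_fintype_card, Fintype.card_coe] at hcard
  push_cast at hcard
  rw [Finset.sum_sub_distrib _ fun _ => (1 : ℤ), Finset.sum_const, nsmul_one]
  linarith
end
end

section
/- Let Γ be a finite connected triangle-free simplicial graph with at least two edges, and let v be an interior vertex of Γ. Then the join J_v = L_v * L_v⊥ is a maximal join subgraph of Γ: it is not properly contained in any full subgraph of Γ which is a join. -/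
noncomputable section

/-! ### Right-angled Artin groups -/

variable {V : Type*}

theorem mem_perp_lk {V : Type*} {Γ : SimpleGraph V} {v x : V} :
    x ∈ perp Γ (lk Γ v) ↔ ∀ u, Γ.Adj v u → x = u ∨ Γ.Adj u x := by
  simp [perp, lk, starOf]

/-- In a triangle-free graph, three vertices are never pairwise adjacent. -/
theorem SimpleGraph.CliqueFree.not_adj_of_adj_of_adj {V : Type*} {Γ : SimpleGraph V}
    (htf : Γ.CliqueFree 3) {a b c : V} (hab : Γ.Adj a b) (hac : Γ.Adj a c) : ¬ Γ.Adj b c := by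
  classical
  intro hbc
  exact htf {a, b, c} (SimpleGraph.is3Clique_triple_iff.2 ⟨hab, hac, hbc⟩)

theorem IsJoin.symm {V : Type*} {Γ : SimpleGraph V} {U W : Set V} (h : IsJoin Γ U W) :
    IsJoin Γ W U := by
  obtain ⟨hU, hW, hd, hUW, hUU, hWW⟩ := h
  exact ⟨hW, hU, hd.symm, fun w hw u hu => (hUW u hu w hw).symm, hWW, hUU⟩

/-- A join having `v` on one side and containing the link of `v` is contained in `J_v`. -/
theorem IsJoin.union_subset_joinOf {V : Type*} {Γ : SimpleGraph V} {U W : Set V} {v : V}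
    (h : IsJoin Γ U W) (hv : v ∈ U) (hlk : lk Γ v ⊆ U ∪ W) :
    U ∪ W ⊆ lk Γ v ∪ perp Γ (lk Γ v) := by
  obtain ⟨-, -, -, hUW, hUU, -⟩ := h
  rintro x (hx | hx)
  · refine Or.inr (mem_perp_lk.2 fun u hu => Or.inr ?_)
    rcases hlk hu with huU | huW
    · exact absurd hu (hUU v hv u huU)
    · exact (hUW x hx u huW).symm
  · exact Or.inl (hUW v hv x hx)

/-- In a triangle-free graph, the link of a vertex of valence at least two and its
orthogonal complement form a join. -/
theorem isJoin_lk_perp {V : Type*} {Γ : SimpleGraph V} (htf : Γ.CliqueFree 3) {v : V}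
    (hv : (lk Γ v).Nontrivial) : IsJoin Γ (lk Γ v) (perp Γ (lk Γ v)) := by
  have hadj : ∀ u ∈ lk Γ v, ∀ x ∈ perp Γ (lk Γ v), Γ.Adj u x := by
    intro u hu x hx
    rcases mem_perp_lk.1 hx u hu with rfl | h
    · obtain ⟨b, hb, hne⟩ := hv.exists_ne x
      rcases mem_perp_lk.1 hx b hb with h | h
      · exact absurd h.symm hne
      · exact absurd h (htf.not_adj_of_adj_of_adj hb hu)
    · exact h
  obtain ⟨a, ha⟩ := hv.nonempty
  refine ⟨⟨a, ha⟩, ⟨v, mem_perp_lk.2 fun u hu => Or.inr hu.symm⟩, ?_, hadj, ?_, ?_⟩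
  · exact Set.disjoint_left.2 fun x hx hx' => Γ.irrefl (hadj x hx x hx')
  · exact fun u hu u' hu' => htf.not_adj_of_adj_of_adj hu hu'
  · exact fun x hx y hy => htf.not_adj_of_adj_of_adj (hadj a ha x hx) (hadj a ha y hy)

/-- In a connected graph with an edge, a vertex which is not a leaf has at least two
neighbours. -/
theorem nontrivial_lk_of_not_isLeaf {V : Type*} {Γ : SimpleGraph V} (hconn : Γ.Connected)
    (hE : Γ.edgeSet.Nonempty) {v : V} (hv : ¬ IsLeaf Γ v) : (lk Γ v).Nontrivial := by
  obtain ⟨e, he⟩ := hE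
  induction e with
  | h a b =>
    have hab : Γ.Adj a b := he
    have : Nontrivial V := ⟨a, b, hab.ne⟩
    obtain ⟨w, hw⟩ := hconn.preconnected.exists_adj_of_nontrivial v
    by_contra h
    refine hv ⟨w, ?_⟩
    exact (Set.not_nontrivial_iff.1 h).eq_singleton_of_mem hw

/-- For an interior vertex `v` of a connected triangle-free graph with at least two
edges, `J_v = L_v * L_v⊥` is a maximal join subgraph of `Γ`. -/
theorem joinOf_is_maximal_join {V : Type*} [Fintype V] (Γ : SimpleGraph V)
    (hconn : Γ.Connected) (htf : Γ.CliqueFree 3) (hE : 2 ≤ Γ.edgeSet.ncard)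
    (v : V) (hv : ¬ IsLeaf Γ v) :
    IsMaximalJoin Γ (lk Γ v) (perp Γ (lk Γ v)) := by
  have hne : Γ.edgeSet.Nonempty := Set.nonempty_of_ncard_ne_zero (by omega)
  refine ⟨isJoin_lk_perp htf (nontrivial_lk_of_not_isLeaf hconn hne hv),
    fun U W hUW hsub => hsub.antisymm ?_⟩
  have hlk : lk Γ v ⊆ U ∪ W := Set.subset_union_left.trans hsub
  rcases hsub (Or.inr (mem_perp_lk.2 fun u hu => Or.inr hu.symm) : v ∈ _) with hvU | hvW
  · exact hUW.union_subset_joinOf hvU hlk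
  · rw [Set.union_comm U W] at hlk ⊢
    exact hUW.symm.union_subset_joinOf hvW hlk
end
end

section
/- The Tits alternative is preserved under abelian extensions and direct products: (1) if G is a group with an abelian normal subgroup N such that G/N satisfies the Tits alternative, then G satisfies the Tits alternative; (2) if G and H both satisfy the Tits alternative, then so does G × H. -/
/-- A group contains a non-abelian free subgroup. -/
def ContainsNonabelianFree (G : Type*) [Group G] : Prop :=
  ∃ f : FreeGroup (Fin 2) →* G, Function.Injective f

/-- A group is virtually solvable. -/
def IsVirtuallySolvable (G : Type*) [Group G] : Prop :=
  ∃ H : Subgroup G, H.FiniteIndex ∧ IsSolvable H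

/-- A group satisfies the Tits alternative: every subgroup either contains a
non-abelian free subgroup or is virtually solvable. -/
def SatisfiesTitsAlternative (G : Type*) [Group G] : Prop :=
  ∀ H : Subgroup G, ContainsNonabelianFree H ∨ IsVirtuallySolvable H

theorem ContainsNonabelianFree.of_surjective {G Q : Type*} [Group G] [Group Q] {f : G →* Q}
    (hf : Function.Surjective f) (hQ : ContainsNonabelianFree Q) : ContainsNonabelianFree G := by
  obtain ⟨φ, hφ⟩ := hQ
  choose s hs using hf
  refine ⟨FreeGroup.lift fun i => s (φ (FreeGroup.of i)), ?_⟩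
  have h : f.comp (FreeGroup.lift fun i => s (φ (FreeGroup.of i))) = φ := by
    ext i
    simp [hs]
  refine Function.Injective.of_comp (f := f) ?_
  rw [← MonoidHom.coe_comp, h]
  exact hφ

theorem IsVirtuallySolvable.of_ker {G Q : Type*} [Group G] [Group Q] (f : G →* Q)
    [Group.IsSolvable f.ker] (hQ : IsVirtuallySolvable Q) : IsVirtuallySolvable G := by
  obtain ⟨S, hS, (hsol : Group.IsSolvable S)⟩ := hQ
  have hle : f.ker ≤ S.comap f := f.ker_le_comap S
  refine ⟨S.comap f, ⟨?_⟩, ?_⟩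
  · rw [S.index_comap f]
    exact Subgroup.FiniteIndex.index_ne_zero (H := S.subgroupOf f.range)
  refine Group.isSolvable_of_ker_le_range (Subgroup.inclusion hle) (f.subgroupComap S) ?_
  intro x hx
  exact ⟨⟨x, congrArg Subtype.val hx⟩, rfl⟩

theorem IsVirtuallySolvable.prod {G H : Type*} [Group G] [Group H]
    (hG : IsVirtuallySolvable G) (hH : IsVirtuallySolvable H) : IsVirtuallySolvable (G × H) := by
  obtain ⟨S, hS, (hSsol : Group.IsSolvable S)⟩ := hG
  obtain ⟨T, hT, (hTsol : Group.IsSolvable T)⟩ := hH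
  refine ⟨S.prod T, ⟨?_⟩, ?_⟩
  · rw [Subgroup.index_prod]
    exact mul_ne_zero hS.index_ne_zero hT.index_ne_zero
  exact Group.isSolvable_of_isSolvable_injective (f := (S.prodEquiv T).toMonoidHom)
    (S.prodEquiv T).injective

theorem SatisfiesTitsAlternative.of_ker {G Q : Type*} [Group G] [Group Q] (f : G →* Q)
    [Group.IsSolvable f.ker] (hQ : SatisfiesTitsAlternative Q) : SatisfiesTitsAlternative G := by
  intro K
  let g : K →* Q := f.comp K.subtype
  refine (hQ g.range).imp (.of_surjective g.rangeRestrict_surjective) fun h => ?_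
  have : Group.IsSolvable g.rangeRestrict.ker := by
    rw [g.ker_rangeRestrict]
    exact Group.isSolvable_of_isSolvable_injective
      (f := (K.subtype.comp g.ker.subtype).codRestrict f.ker fun x => x.2)
      fun x y hxy => Subtype.ext (Subtype.ext (Subtype.ext_iff.1 hxy :))
  exact h.of_ker g.rangeRestrict

theorem SatisfiesTitsAlternative.prod {G H : Type*} [Group G] [Group H]
    (hG : SatisfiesTitsAlternative G) (hH : SatisfiesTitsAlternative H) :
    SatisfiesTitsAlternative (G × H) := by
  intro K
  let p : K →* G := (MonoidHom.fst G H).comp K.subtype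
  let q : K →* H := (MonoidHom.snd G H).comp K.subtype
  rcases hG p.range with hp | hp
  · exact .inl (.of_surjective p.rangeRestrict_surjective hp)
  rcases hH q.range with hq | hq
  · exact .inl (.of_surjective q.rangeRestrict_surjective hq)
  let r := p.rangeRestrict.prod q.rangeRestrict
  have hr : Function.Injective r := fun x y hxy =>
    Subtype.ext (Prod.ext (congrArg (fun z => (z.1 : G)) hxy) (congrArg (fun z => (z.2 : H)) hxy))
  have : Group.IsSolvable r.ker := by
    rw [(MonoidHom.ker_eq_bot_iff r).2 hr]
    infer_instance
  exact .inr ((hp.prod hq).of_ker r)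

/-- The Tits alternative is preserved under abelian extensions and under direct
products. -/
theorem titsAlternative_abelian_extension_and_prod :
    (∀ (G : Type*) [Group G] (N : Subgroup G) [N.Normal],
      (∀ a b : N, a * b = b * a) →
      SatisfiesTitsAlternative (G ⧸ N) → SatisfiesTitsAlternative G) ∧
    (∀ (G H : Type*) [Group G] [Group H],
      SatisfiesTitsAlternative G → SatisfiesTitsAlternative H →
      SatisfiesTitsAlternative (G × H)) := by
  refine ⟨fun G _ N _ hN hQ => ?_, fun G H _ _ hG hH => hG.prod hH⟩
  have : Group.IsSolvable (QuotientGroup.mk' N).ker := by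
    rw [QuotientGroup.ker_mk']
    exact Group.isSolvable_of_comm hN
  exact hQ.of_ker (QuotientGroup.mk' N)
end
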